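/- arXiv:2010.14320 — 8 statements merged into one kernel-verified Lean document; each statement's English description precedes it below -/
import Mathlib

section
/- Let v:[0,1]→ℝ be a convex, twice differentiable function. For 0≤t<1 and 0<x≤1−t define v(x,t) := v(x+t) + x·log x − (x+t)·log(x+t). For every fixed t∈(0,1) the map x ↦ ∂₁v(x,t) is strictly increasing on (0,1−t); let J(·,t) denote its inverse function, so that J(∂₁v(x,t),t)=x, defined for y in the range −∞ < y < v'(1) + log(1−t). Then the function Ψ(r,t) := J(log r, t) solves the O'Rourke–Steinerberger PDE in distribution-function form, ∂Ψ/∂t(r,t) = r·(∂Ψ/∂r)(r,t)/Ψ(r,t) − 1, for all t∈(0,1) and 0 < r < (1−t)·e^{v'(1)}. -/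
open Set Filter Topology

/-- The slope `∂₁w` expressed in the variable `z = x + t`. -/
noncomputable def shiftedSlope (u : ℝ → ℝ) (z t : ℝ) : ℝ :=
  u z + Real.log (z - t) - Real.log z

theorem shiftedSlope_strictMonoOn {u : ℝ → ℝ} (hu : MonotoneOn u (Ioo 0 1)) {t : ℝ} (ht : 0 < t) :
    StrictMonoOn (fun z => shiftedSlope u z t) (Ioo t 1) := by
  intro a ha b hb hab
  have ha0 : 0 < a := ht.trans ha.1
  have hb0 : 0 < b := ht.trans hb.1
  have h1 : u a ≤ u b := hu ⟨ha0, ha.2⟩ ⟨hb0, hb.2⟩ hab.le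
  have h2 : Real.log (a - t) - Real.log a < Real.log (b - t) - Real.log b := by
    rw [← Real.log_div (sub_pos.2 ha.1).ne' ha0.ne', ← Real.log_div (sub_pos.2 hb.1).ne' hb0.ne']
    apply Real.log_lt_log (div_pos (sub_pos.2 ha.1) ha0)
    rw [div_lt_div_iff₀ ha0 hb0]
    nlinarith
  simp only [shiftedSlope]
  linarith

theorem hasDerivAt_shiftedSlope {u : ℝ → ℝ} {u' z t : ℝ} (hu : HasDerivAt u u' z)
    (hz : z ≠ 0) (hzt : z - t ≠ 0) :
    HasDerivAt (fun z => shiftedSlope u z t) (u' + 1 / (z - t) - 1 / z) z :=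
  (hu.add (((hasDerivAt_id z).sub_const t).log hzt)).sub ((hasDerivAt_id z).log hz)

theorem continuousAt_shiftedSlope_right (u : ℝ → ℝ) {z t : ℝ} (hzt : z - t ≠ 0) :
    ContinuousAt (fun s => shiftedSlope u z s) t := by
  unfold shiftedSlope
  exact (continuousAt_const.add ((continuousAt_const.sub continuousAt_id).log hzt)).sub
    continuousAt_const

theorem exists_shiftedSlope_eq_log {u : ℝ → ℝ} (hu : ContinuousOn u (Icc 0 1)) {t r : ℝ}
    (ht : t ∈ Ioo (0 : ℝ) 1) (hr : r ∈ Ioo 0 ((1 - t) * Real.exp (u 1))) :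
    ∃ z ∈ Ioo t 1, shiftedSlope u z t = Real.log r := by
  have hc : ContinuousOn (fun z => (z - t) / z * Real.exp (u z)) (Icc t 1) := by
    refine ContinuousOn.mul (ContinuousOn.div (by fun_prop) continuousOn_id ?_) ?_
    · intro z hz
      exact (ht.1.trans_le hz.1).ne'
    · exact (hu.mono (Icc_subset_Icc_left ht.1.le)).rexp
  obtain ⟨z, hz, hzr⟩ := intermediate_value_Ioo ht.2.le hc (by simpa using hr)
  have hz0 : 0 < z := ht.1.trans hz.1
  have hzt : 0 < z - t := sub_pos.2 hz.1
  refine ⟨z, hz, ?_⟩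
  rw [← hzr, Real.log_mul (div_pos hzt hz0).ne' (Real.exp_pos _).ne', Real.log_exp,
    Real.log_div hzt.ne' hz0.ne', shiftedSlope]
  ring

/-- Solutions of `shiftedSlope u z p.1 = p.2` persist near a given one under perturbation
of the parameters `p`. -/
theorem eventually_exists_shiftedSlope_eq {u : ℝ → ℝ} (hu : MonotoneOn u (Ioo 0 1))
    (huc : ContinuousOn u (Ioo 0 1)) {t z : ℝ} (ht : 0 < t) (hz : z ∈ Ioo t 1)
    {U : Set ℝ} (hU : U ∈ 𝓝 z) :
    ∀ᶠ p : ℝ × ℝ in 𝓝 (t, shiftedSlope u z t),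
      0 < p.1 ∧ ∃ x ∈ U, x ∈ Ioo p.1 1 ∧ shiftedSlope u x p.1 = p.2 := by
  have hV : U ∩ Ioo t 1 ∈ 𝓝 z := inter_mem hU (Ioo_mem_nhds hz.1 hz.2)
  obtain ⟨ε, hε, hεV⟩ := Metric.nhds_basis_closedBall.mem_iff.1 hV
  rw [Real.closedBall_eq_Icc] at hεV
  have ha := hεV (left_mem_Icc.2 (by linarith))
  have hb := hεV (right_mem_Icc.2 (by linarith))
  have hmono := shiftedSlope_strictMonoOn hu ht
  have hlo : shiftedSlope u (z - ε) t < shiftedSlope u z t := hmono ha.2 hz (by linarith)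
  have hhi : shiftedSlope u z t < shiftedSlope u (z + ε) t := hmono hz hb.2 (by linarith)
  have h1 : Tendsto (fun p : ℝ × ℝ => p.1) (𝓝 (t, shiftedSlope u z t)) (𝓝 t) :=
    continuous_fst.tendsto _
  have h2 : Tendsto (fun p : ℝ × ℝ => p.2) (𝓝 (t, shiftedSlope u z t))
      (𝓝 (shiftedSlope u z t)) := continuous_snd.tendsto _
  have hca := (continuousAt_shiftedSlope_right u (sub_pos.2 ha.2.1).ne').tendsto.comp h1
  have hcb := (continuousAt_shiftedSlope_right u (sub_pos.2 hb.2.1).ne').tendsto.comp h1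
  filter_upwards [hca.eventually_lt h2 hlo, h2.eventually_lt hcb hhi,
    h1.eventually (lt_mem_nhds ht), h1.eventually (gt_mem_nhds ha.2.1)] with p hpa hpb hp0 hp
  have hc : ContinuousOn (fun x => shiftedSlope u x p.1) (Icc (z - ε) (z + ε)) := by
    unfold shiftedSlope
    refine ((huc.mono fun x hx => ⟨ht.trans (hεV hx).2.1, (hεV hx).2.2⟩).add
      (ContinuousOn.log (by fun_prop) fun x hx => ?_)).sub
      (continuousOn_id.log fun x hx => (ht.trans (hεV hx).2.1).ne')
    exact (sub_pos.2 (hp.trans_le hx.1)).ne'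
  obtain ⟨x, hx, hxp⟩ := intermediate_value_Icc (by linarith) hc ⟨hpa.le, hpb.le⟩
  exact ⟨hp0, x, (hεV hx).1, ⟨hp.trans_le hx.1, (hεV hx).2.2⟩, hxp⟩

section Inverse

variable {u : ℝ → ℝ} {Z : ℝ → ℝ → ℝ} {t z u' : ℝ}

theorem tendsto_shiftedSlope_inverse (hu : MonotoneOn u (Ioo 0 1))
    (huc : ContinuousOn u (Ioo 0 1))
    (hZ : ∀ s ∈ Ioo (0 : ℝ) 1, ∀ x ∈ Ioo s 1, Z (shiftedSlope u x s) s = x)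
    (ht : 0 < t) (hz : z ∈ Ioo t 1) :
    Tendsto (fun p : ℝ × ℝ => Z p.2 p.1) (𝓝 (t, shiftedSlope u z t)) (𝓝 z) := by
  intro U hU
  rw [mem_map]
  filter_upwards [eventually_exists_shiftedSlope_eq hu huc ht hz hU]
  rintro p ⟨hp, x, hxU, hx, hxp⟩
  rw [mem_preimage, ← hxp, hZ p.1 ⟨hp, hx.1.trans hx.2⟩ x hx]
  exact hxU

theorem eventually_shiftedSlope_inverse (hu : MonotoneOn u (Ioo 0 1))
    (huc : ContinuousOn u (Ioo 0 1))
    (hZ : ∀ s ∈ Ioo (0 : ℝ) 1, ∀ x ∈ Ioo s 1, Z (shiftedSlope u x s) s = x)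
    (ht : 0 < t) (hz : z ∈ Ioo t 1) :
    ∀ᶠ p : ℝ × ℝ in 𝓝 (t, shiftedSlope u z t),
      0 < p.1 ∧ Z p.2 p.1 ∈ Ioo p.1 1 ∧ shiftedSlope u (Z p.2 p.1) p.1 = p.2 := by
  filter_upwards [eventually_exists_shiftedSlope_eq hu huc ht hz univ_mem]
  rintro p ⟨hp, x, -, hx, hxp⟩
  have h := hZ p.1 ⟨hp, hx.1.trans hx.2⟩ x hx
  rw [hxp] at h
  rw [h]
  exact ⟨hp, hx, hxp⟩

theorem hasDerivAt_shiftedSlope_inverse_left (hu : MonotoneOn u (Ioo 0 1))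
    (huc : ContinuousOn u (Ioo 0 1)) (hu' : HasDerivAt u u' z) (hnonneg : 0 ≤ u')
    (hZ : ∀ s ∈ Ioo (0 : ℝ) 1, ∀ x ∈ Ioo s 1, Z (shiftedSlope u x s) s = x)
    (ht : 0 < t) (hz : z ∈ Ioo t 1) :
    HasDerivAt (fun y => Z y t) (u' + 1 / (z - t) - 1 / z)⁻¹ (shiftedSlope u z t) := by
  have hz0 : 0 < z := ht.trans hz.1
  have hzt : 0 < z - t := sub_pos.2 hz.1
  have hval : Z (shiftedSlope u z t) t = z := hZ t ⟨ht, hz.1.trans hz.2⟩ z hz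
  have hc : Tendsto (fun y => (t, y)) (𝓝 (shiftedSlope u z t)) (𝓝 (t, shiftedSlope u z t)) :=
    (Continuous.prodMk_right t).tendsto _
  have hlt : 1 / z < 1 / (z - t) := one_div_lt_one_div_of_lt hzt (by linarith)
  refine HasDerivAt.of_local_left_inverse (f := fun z => shiftedSlope u z t) ?_ ?_ ?_ ?_
  · simpa only [ContinuousAt, hval] using! (tendsto_shiftedSlope_inverse hu huc hZ ht hz).comp hc
  · rw [hval]
    exact hasDerivAt_shiftedSlope hu' hz0.ne' hzt.ne'
  · exact ne_of_gt (by linarith)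
  · exact (hc.eventually (eventually_shiftedSlope_inverse hu huc hZ ht hz)).mono fun y hy => hy.2.2

theorem hasDerivAt_shiftedSlope_inverse_right (hu : MonotoneOn u (Ioo 0 1))
    (huc : ContinuousOn u (Ioo 0 1)) (hu' : HasDerivAt u u' z) (hnonneg : 0 ≤ u')
    (hZ : ∀ s ∈ Ioo (0 : ℝ) 1, ∀ x ∈ Ioo s 1, Z (shiftedSlope u x s) s = x)
    (ht : 0 < t) (hz : z ∈ Ioo t 1) :
    HasDerivAt (fun s => Z (shiftedSlope u z t) s) (t / z + (z - t) * u')⁻¹ t := by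
  have hz0 : 0 < z := ht.trans hz.1
  have hzt : 0 < z - t := sub_pos.2 hz.1
  set y := shiftedSlope u z t with hy
  have hval : Z y t = z := hZ t ⟨ht, hz.1.trans hz.2⟩ z hz
  have key : ∀ {x s : ℝ}, 0 < x → s < x → shiftedSlope u x s = y →
      x * Real.exp (y - u x) = x - s := by
    intro x s hx hs hxs
    have : y - u x = Real.log (x - s) - Real.log x := by rw [← hxs, shiftedSlope]; ring
    rw [this, Real.exp_sub, Real.exp_log (sub_pos.2 hs), Real.exp_log hx]
    field_simp
  have hc : Tendsto (fun s => (s, y)) (𝓝 t) (𝓝 (t, y)) := (Continuous.prodMk_left y).tendsto _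
  refine HasDerivAt.of_local_left_inverse (f := fun x => x - x * Real.exp (y - u x)) ?_ ?_ ?_ ?_
  · simpa only [ContinuousAt, hval] using! (tendsto_shiftedSlope_inverse hu huc hZ ht hz).comp hc
  · rw [hval]
    have h := (hasDerivAt_id z).sub ((hasDerivAt_id z).mul (hu'.const_sub y).exp)
    refine h.congr_deriv ?_
    have he := key hz0 hz.1 hy.symm
    have he' : Real.exp (y - u z) = (z - t) / z := by rw [eq_div_iff hz0.ne', ← he, mul_comm]
    simp only [id, he']
    field_simp
    ring
  · have := div_pos ht hz0
    positivity
  · filter_upwards [hc.eventually (eventually_shiftedSlope_inverse hu huc hZ ht hz)]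
    rintro s ⟨hs0, hs, hsy⟩
    rw [key (hs0.trans hs.1) hs.1 hsy]
    ring

end Inverse

theorem ConvexOn.monotoneOn_of_hasDerivAt {S : Set ℝ} {f f' : ℝ → ℝ} (hf : ConvexOn ℝ S f)
    (hd : ∀ x ∈ S, HasDerivAt f (f' x) x) : MonotoneOn f' S :=
  (hf.monotoneOn_deriv fun x hx => (hd x hx).differentiableAt).congr fun x hx => (hd x hx).deriv

theorem deriv_eq_shiftedSlope {v v' : ℝ → ℝ} (hv : ∀ z ∈ Ioo (0 : ℝ) 1, HasDerivAt v (v' z) z)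
    {t x : ℝ} (ht : 0 < t) (hx : x ∈ Ioo 0 (1 - t)) :
    deriv (fun y => v (y + t) + y * Real.log y - (y + t) * Real.log (y + t)) x =
      shiftedSlope v' (x + t) t := by
  have hxt : 0 < x + t := add_pos hx.1 ht
  have h1 := (hv (x + t) ⟨hxt, by linarith [hx.2]⟩).comp_add_const x t
  have h2 := Real.hasDerivAt_mul_log hx.1.ne'
  have h3 := (Real.hasDerivAt_mul_log hxt.ne').comp_add_const x t
  refine ((h1.add h2).sub h3).deriv.trans ?_
  rw [shiftedSlope, add_sub_cancel_right]
  ring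


/-- Let `v : [0,1] → ℝ` be convex and twice differentiable, and define
`w(x,t) = v(x+t) + x log x − (x+t) log(x+t)`.  For every fixed `t ∈ (0,1)` the map
`x ↦ ∂₁w(x,t)` is strictly increasing on `(0, 1−t)`; if `J(·,t)` is its inverse
(`J(∂₁w(x,t), t) = x`), then `Ψ(r,t) := J(log r, t)` solves the O'Rourke–Steinerberger
PDE `∂Ψ/∂t = r · (∂Ψ/∂r)/Ψ − 1` for `t ∈ (0,1)` and `0 < r < (1−t)·e^{v'(1)}`. -/
theorem stmt_0 (v v' v'' : ℝ → ℝ)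
    (hconv : ConvexOn ℝ (Set.Icc 0 1) v)
    (hd1 : ∀ x ∈ Set.Icc (0:ℝ) 1, HasDerivWithinAt v (v' x) (Set.Icc 0 1) x)
    (hd2 : ∀ x ∈ Set.Icc (0:ℝ) 1, HasDerivWithinAt v' (v'' x) (Set.Icc 0 1) x)
    (J : ℝ → ℝ → ℝ)
    (hJ : ∀ t ∈ Set.Ioo (0:ℝ) 1, ∀ x ∈ Set.Ioo (0:ℝ) (1 - t),
      J (deriv (fun y => v (y + t) + y * Real.log y - (y + t) * Real.log (y + t)) x) t = x) :
    (∀ t ∈ Set.Ioo (0:ℝ) 1,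
      StrictMonoOn
        (fun x => deriv (fun y => v (y + t) + y * Real.log y - (y + t) * Real.log (y + t)) x)
        (Set.Ioo 0 (1 - t))) ∧
    (∀ t ∈ Set.Ioo (0:ℝ) 1, ∀ r ∈ Set.Ioo (0:ℝ) ((1 - t) * Real.exp (v' 1)),
      deriv (fun s => J (Real.log r) s) t
        = r * deriv (fun ρ => J (Real.log ρ) t) r / J (Real.log r) t - 1) := by
  have hv : ∀ z ∈ Ioo (0 : ℝ) 1, HasDerivAt v (v' z) z := fun z hz =>
    (hd1 z (Ioo_subset_Icc_self hz)).hasDerivAt (Icc_mem_nhds hz.1 hz.2)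
  have hv' : ∀ z ∈ Ioo (0 : ℝ) 1, HasDerivAt v' (v'' z) z := fun z hz =>
    (hd2 z (Ioo_subset_Icc_self hz)).hasDerivAt (Icc_mem_nhds hz.1 hz.2)
  have hcont : ContinuousOn v' (Icc 0 1) := fun z hz => (hd2 z hz).continuousWithinAt
  have hcont' := hcont.mono Ioo_subset_Icc_self
  have hmono : MonotoneOn v' (Ioo 0 1) :=
    (hconv.subset Ioo_subset_Icc_self (convex_Ioo 0 1)).monotoneOn_of_hasDerivAt hv
  have hJ' : ∀ s ∈ Ioo (0 : ℝ) 1, ∀ x ∈ Ioo s 1, J (shiftedSlope v' x s) s + s = x := by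
    intro s hs x hx
    have hxs : x - s ∈ Ioo 0 (1 - s) := ⟨sub_pos.2 hx.1, by linarith [hx.2]⟩
    have h := hJ s hs (x - s) hxs
    rw [deriv_eq_shiftedSlope hv hs.1 hxs, sub_add_cancel] at h
    linarith
  refine ⟨fun t ht a ha b hb hab => ?_, fun t ht r hr => ?_⟩
  · simp only [deriv_eq_shiftedSlope hv ht.1 ha, deriv_eq_shiftedSlope hv ht.1 hb]
    exact shiftedSlope_strictMonoOn hmono ht.1 ⟨by linarith [ha.1], by linarith [ha.2]⟩
      ⟨by linarith [hb.1], by linarith [hb.2]⟩ (by linarith)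
  · obtain ⟨z, hz, hzr⟩ := exists_shiftedSlope_eq_log hcont ht hr
    have hz0 : 0 < z := ht.1.trans hz.1
    have hzt : 0 < z - t := sub_pos.2 hz.1
    have hz' := hv' z ⟨hz0, hz.2⟩
    have hnonneg : 0 ≤ v'' z := by
      refine hz'.hasDerivWithinAt.nonneg_of_monotoneOn ?_ hmono
      exact uniqueDiffWithinAt_iff_accPt.1 (isOpen_Ioo.uniqueDiffWithinAt ⟨hz0, hz.2⟩)
    have hval : J (Real.log r) t = z - t := by
      rw [← hzr]
      exact eq_sub_of_add_eq (hJ' t ht z hz)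
    have hL := hasDerivAt_shiftedSlope_inverse_left (Z := fun y s => J y s + s)
      hmono hcont' hz' hnonneg hJ' ht.1 hz
    have hR := hasDerivAt_shiftedSlope_inverse_right (Z := fun y s => J y s + s)
      hmono hcont' hz' hnonneg hJ' ht.1 hz
    rw [hzr] at hL hR
    have hρ : HasDerivAt (fun ρ => J (Real.log ρ) t)
        ((v'' z + 1 / (z - t) - 1 / z)⁻¹ * r⁻¹) r := by
      have h := (hL.sub_const t).comp r (Real.hasDerivAt_log hr.1.ne')
      simpa [Function.comp_def] using h
    have hs : HasDerivAt (fun s => J (Real.log r) s) ((t / z + (z - t) * v'' z)⁻¹ - 1) t := by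
      refine (hR.sub (hasDerivAt_id t)).congr_of_eventuallyEq (.of_forall fun s => ?_)
      simp
    have hE : t / z + (z - t) * v'' z = (z - t) * (v'' z + 1 / (z - t) - 1 / z) := by
      field_simp
      ring
    rw [hs.deriv, hρ.deriv, hval, hE, mul_inv]
    have hr0 := hr.1.ne'
    field_simp
end

section
/- Let r > 0. The function Ψ(x,t) := tx/(r−x) solves the PDE ∂Ψ/∂t(x,t) = x·(∂Ψ/∂x)(x,t)/Ψ(x,t) − 1 for all 0 < x < r and t > 0. Equivalently, its x-derivative ψ(x,t) = tr/(r−x)² solves the density-form O'Rourke–Steinerberger equation there. (The case r=1, restricted to 0<x<1−t with 0<t<1, is the evolution of the zeroes of Kac polynomials, whose radial parts start uniformly on the unit circle.) -/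
/-- For `r > 0`, the function `Ψ(x,t) = t·x/(r−x)` solves the PDE
`∂Ψ/∂t = x·(∂Ψ/∂x)/Ψ − 1` for `0 < x < r`, `t > 0`; its `x`-derivative equals
`ψ(x,t) = t·r/(r−x)²`, and `ψ` solves the density-form O'Rourke–Steinerberger equation
`∂ψ/∂t = ∂/∂x (x·ψ/Ψ)` there. -/
theorem stmt_5 (r : ℝ) (hr : 0 < r) :
    ∀ t > (0:ℝ), ∀ x ∈ Set.Ioo (0:ℝ) r,
      deriv (fun s => s * x / (r - x)) t
          = x * deriv (fun y => t * y / (r - y)) x / (t * x / (r - x)) - 1 ∧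
      deriv (fun y => t * y / (r - y)) x = t * r / (r - x) ^ 2 ∧
      deriv (fun s => s * r / (r - x) ^ 2) t
          = deriv (fun y => y * (t * r / (r - y) ^ 2) / (t * y / (r - y))) x := by
  rintro t ht x ⟨hx, hxr⟩
  have hrx : r - x ≠ 0 := (sub_pos.mpr hxr).ne'
  have hsub : HasDerivAt (fun y : ℝ => r - y) (-1) x := (hasDerivAt_id' x).const_sub r
  have hΨ : deriv (fun y => t * y / (r - y)) x = t * r / (r - x) ^ 2 := by
    rw [(((hasDerivAt_id' x).const_mul t).fun_div hsub hrx).deriv]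
    ring
  refine ⟨?_, hΨ, ?_⟩
  · rw [hΨ, (((hasDerivAt_id' t).mul_const x).div_const (r - x)).deriv]
    field_simp
    ring
  · have hcongr : (fun y => y * (t * r / (r - y) ^ 2) / (t * y / (r - y))) =ᶠ[nhds x]
        fun y => r / (r - y) := by
      filter_upwards [Ioo_mem_nhds hx hxr] with y hy
      have hy0 : y ≠ 0 := hy.1.ne'
      have hry : r - y ≠ 0 := (sub_pos.mpr hy.2).ne'
      field_simp
    rw [hcongr.deriv_eq, ((hasDerivAt_const x r).fun_div hsub hrx).deriv,
      (((hasDerivAt_id' t).mul_const r).div_const ((r - x) ^ 2)).deriv]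
    ring
end

section
/- Let α > 0 and let Ψ be a positive continuously differentiable function of (x,t) on a domain where 0<t<1 and 0<x<1−t, satisfying the implicit equation Ψ(x,t)·(Ψ(x,t)+t)^{α−1} = x (equivalently, (α−1)·log(Ψ(x,t)+t) + log Ψ(x,t) = log x) throughout the domain. Then Ψ solves the PDE ∂Ψ/∂t(x,t) = x·(∂Ψ/∂x)(x,t)/Ψ(x,t) − 1 on that domain. -/
/-- Let `α > 0` and let `Ψ` be positive and continuously differentiable on
`{(x,t) : 0 < t < 1, 0 < x < 1−t}`, satisfying `Ψ·(Ψ+t)^{α−1} = x` there.  Then `Ψ` solves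
the PDE `∂Ψ/∂t = x·(∂Ψ/∂x)/Ψ − 1` on that domain. -/
theorem stmt_6 (α : ℝ) (hα : 0 < α) (Ψ : ℝ → ℝ → ℝ)
    (hpos : ∀ t ∈ Set.Ioo (0:ℝ) 1, ∀ x ∈ Set.Ioo (0:ℝ) (1 - t), 0 < Ψ x t)
    (hC1 : ContDiffOn ℝ 1 (fun p : ℝ × ℝ => Ψ p.1 p.2)
      {p : ℝ × ℝ | 0 < p.2 ∧ p.2 < 1 ∧ 0 < p.1 ∧ p.1 < 1 - p.2})
    (himpl : ∀ t ∈ Set.Ioo (0:ℝ) 1, ∀ x ∈ Set.Ioo (0:ℝ) (1 - t),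
      Ψ x t * (Ψ x t + t) ^ (α - 1) = x) :
    ∀ t ∈ Set.Ioo (0:ℝ) 1, ∀ x ∈ Set.Ioo (0:ℝ) (1 - t),
      deriv (fun s => Ψ x s) t = x * deriv (fun y => Ψ y t) x / Ψ x t - 1 := by
  intro t ht x hx
  have hlog : ∀ s ∈ Set.Ioo (0:ℝ) 1, ∀ y ∈ Set.Ioo (0:ℝ) (1 - s),
      Real.log (Ψ y s) + (α - 1) * Real.log (Ψ y s + s) = Real.log y := by
    intro s hs y hy
    have hP := hpos s hs y hy
    have hPs : 0 < Ψ y s + s := add_pos hP hs.1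
    rw [← Real.log_rpow hPs, ← Real.log_mul hP.ne' (Real.rpow_pos_of_pos hPs _).ne',
      himpl s hs y hy]
  have hopen : IsOpen {p : ℝ × ℝ | 0 < p.2 ∧ p.2 < 1 ∧ 0 < p.1 ∧ p.1 < 1 - p.2} :=
    (isOpen_lt continuous_const continuous_snd).inter <|
      (isOpen_lt continuous_snd continuous_const).inter <|
        (isOpen_lt continuous_const continuous_fst).inter <|
          isOpen_lt continuous_fst (continuous_const.sub continuous_snd)
  have hdiff : DifferentiableAt ℝ (fun p : ℝ × ℝ => Ψ p.1 p.2) (x, t) :=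
    (hC1.contDiffAt (hopen.mem_nhds ⟨ht.1, ht.2, hx.1, hx.2⟩)).differentiableAt one_ne_zero
  have hdx : HasDerivAt (fun y => Ψ y t) (deriv (fun y => Ψ y t) x) x :=
    (hdiff.comp (f := fun y : ℝ => (y, t)) x (by fun_prop)).hasDerivAt
  have hdt : HasDerivAt (fun s => Ψ x s) (deriv (fun s => Ψ x s) t) t :=
    (hdiff.comp (f := fun s : ℝ => (x, s)) t (by fun_prop)).hasDerivAt
  have hP := hpos t ht x hx
  have hPt : 0 < Ψ x t + t := add_pos hP ht.1
  have hx0 : 0 < x := hx.1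
  have hderivx := ((hdx.log hP.ne').add
    (((hdx.add_const t).log hPt.ne').const_mul (α - 1))).unique
    ((Real.hasDerivAt_log hx0.ne').congr_of_eventuallyEq <| by
      filter_upwards [isOpen_Ioo.mem_nhds hx] with y hy using hlog t ht y hy)
  have hderivt := ((hdt.log hP.ne').add
    (((hdt.add (hasDerivAt_id t)).log hPt.ne').const_mul (α - 1))).unique
    ((hasDerivAt_const t (Real.log x)).congr_of_eventuallyEq <| by
      filter_upwards [isOpen_Ioo.mem_nhds ht, isOpen_Iio.mem_nhds (show t < 1 - x by linarith [hx.2])]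
        with s hs hsx
      exact hlog s hs x ⟨hx0, by linarith [Set.mem_Iio.mp hsx]⟩)
  simp only [Pi.add_apply, id] at hderivt
  generalize deriv (fun s => Ψ x s) t = a at *
  generalize deriv (fun y => Ψ y t) x = b at *
  generalize Ψ x t = P at *
  have ht0 := ht.1
  field_simp at hderivx hderivt ⊢
  have hK : α * P + t ≠ 0 := by positivity
  apply mul_left_cancel₀ hK
  linear_combination P * hderivt - hderivx
end

section
/- The function Ψ(x,t) := (x² + √(x⁴ + 4x²t))/2 satisfies the quadratic equation Ψ² − x²Ψ − x²t = 0 and solves the PDE ∂Ψ/∂t(x,t) = x·(∂Ψ/∂x)(x,t)/Ψ(x,t) − 1 for all 0<x<1−t and 0<t<1. Its x-derivative equals ψ(x,t) = x + (x²+2t)/√(x²+4t). -/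
/-- The distribution function of the radial parts for the Weyl case `α = 1/2`
(zeroes uniform on the unit disk). -/
noncomputable def PsiWeyl (x t : ℝ) : ℝ := (x ^ 2 + Real.sqrt (x ^ 4 + 4 * x ^ 2 * t)) / 2

theorem PsiWeyl_eq_of_nonneg {x : ℝ} (hx : 0 ≤ x) (t : ℝ) :
    PsiWeyl x t = (x ^ 2 + x * Real.sqrt (x ^ 2 + 4 * t)) / 2 := by
  rw [PsiWeyl, show x ^ 4 + 4 * x ^ 2 * t = x ^ 2 * (x ^ 2 + 4 * t) by ring,
    Real.sqrt_mul (sq_nonneg x), Real.sqrt_sq hx]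

theorem hasDerivAt_PsiWeyl_time {x t : ℝ} (hx : 0 ≤ x) (h : 0 < x ^ 2 + 4 * t) :
    HasDerivAt (fun s => PsiWeyl x s) (x / Real.sqrt (x ^ 2 + 4 * t)) t := by
  have h1 : HasDerivAt (fun s : ℝ => x ^ 2 + 4 * s) 4 t := by
    simpa using ((hasDerivAt_id t).const_mul 4).const_add (x ^ 2)
  have h2 := (((h1.sqrt h.ne').const_mul x).const_add (x ^ 2)).div_const 2
  simp only [PsiWeyl_eq_of_nonneg hx]
  refine h2.congr_deriv ?_
  have := (Real.sqrt_pos.2 h).ne'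
  field_simp
  norm_num

theorem hasDerivAt_PsiWeyl_space {x t : ℝ} (hx : 0 < x) (h : 0 < x ^ 2 + 4 * t) :
    HasDerivAt (fun y => PsiWeyl y t)
      (x + (x ^ 2 + 2 * t) / Real.sqrt (x ^ 2 + 4 * t)) x := by
  have h1 : HasDerivAt (fun y : ℝ => y ^ 2) (2 * x) x := by
    simpa using hasDerivAt_pow 2 x
  have h2 := (h1.add ((hasDerivAt_id x).mul ((h1.add_const (4 * t)).sqrt h.ne'))).div_const 2
  refine (h2.congr_of_eventuallyEq ?_).congr_deriv ?_
  · filter_upwards [lt_mem_nhds hx] with y hy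
    exact PsiWeyl_eq_of_nonneg hy.le t
  · have hr := (Real.sqrt_pos.2 h).ne'
    have hsq := Real.sq_sqrt h.le
    simp only [id]
    field_simp
    linear_combination hsq

/-- `Ψ(x,t) = (x² + √(x⁴+4x²t))/2` satisfies `Ψ² − x²Ψ − x²t = 0` and solves
`∂Ψ/∂t = x·(∂Ψ/∂x)/Ψ − 1` for `0 < x < 1−t`, `0 < t < 1`; its `x`-derivative equals
`x + (x²+2t)/√(x²+4t)`. -/
theorem stmt_7 :
    ∀ t ∈ Set.Ioo (0:ℝ) 1, ∀ x ∈ Set.Ioo (0:ℝ) (1 - t),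
      (PsiWeyl x t) ^ 2 - x ^ 2 * PsiWeyl x t - x ^ 2 * t = 0 ∧
      deriv (fun s => PsiWeyl x s) t
          = x * deriv (fun y => PsiWeyl y t) x / PsiWeyl x t - 1 ∧
      deriv (fun y => PsiWeyl y t) x
          = x + (x ^ 2 + 2 * t) / Real.sqrt (x ^ 2 + 4 * t) := by
  rintro t ⟨ht, -⟩ x ⟨hx, -⟩
  have h : 0 < x ^ 2 + 4 * t := by positivity
  have hr := Real.sqrt_pos.2 h
  have hsq := Real.sq_sqrt h.le
  rw [(hasDerivAt_PsiWeyl_time hx.le h).deriv, (hasDerivAt_PsiWeyl_space hx h).deriv,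
    PsiWeyl_eq_of_nonneg hx.le]
  generalize Real.sqrt (x ^ 2 + 4 * t) = r at hr hsq ⊢
  refine ⟨by linear_combination x ^ 2 / 4 * hsq, ?_, rfl⟩
  have hsum : x + r ≠ 0 := by positivity
  rw [show (x ^ 2 + x * r) / 2 = x * (x + r) / 2 by ring]
  field_simp
  linear_combination hsq
end

section
/- The function Ψ(x,t) := (−t + √(t² + 4x))/2 satisfies the quadratic equation Ψ² + tΨ − x = 0 and solves the PDE ∂Ψ/∂t(x,t) = x·(∂Ψ/∂x)(x,t)/Ψ(x,t) − 1 for all 0<x<1−t and 0<t<1. Its x-derivative equals ψ(x,t) = 1/√(t²+4x). -/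
/-- The distribution function of the radial parts for the case `α = 2`
(square roots of radial parts initially uniform on `[0,1]`). -/
noncomputable def PsiSqrt (x t : ℝ) : ℝ := (-t + Real.sqrt (t ^ 2 + 4 * x)) / 2

theorem PsiSqrt_sq_add_mul_sub {x t : ℝ} (h : 0 ≤ t ^ 2 + 4 * x) :
    PsiSqrt x t ^ 2 + t * PsiSqrt x t - x = 0 := by
  unfold PsiSqrt
  linear_combination Real.sq_sqrt h / 4

theorem hasDerivAt_PsiSqrt_left {x t : ℝ} (h : 0 < t ^ 2 + 4 * x) :
    HasDerivAt (fun y => PsiSqrt y t) (1 / Real.sqrt (t ^ 2 + 4 * x)) x := by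
  have hd : HasDerivAt (fun y : ℝ => t ^ 2 + 4 * y) 4 x := by
    simpa using ((hasDerivAt_id x).const_mul 4).const_add (t ^ 2)
  have hs : Real.sqrt (t ^ 2 + 4 * x) ≠ 0 := (Real.sqrt_pos.2 h).ne'
  refine (((hd.sqrt h.ne').const_add (-t)).div_const 2).congr_deriv ?_
  field_simp
  norm_num

theorem hasDerivAt_PsiSqrt_right {x t : ℝ} (h : 0 < t ^ 2 + 4 * x) :
    HasDerivAt (fun s => PsiSqrt x s) ((-1 + t / Real.sqrt (t ^ 2 + 4 * x)) / 2) t := by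
  have hd : HasDerivAt (fun s : ℝ => s ^ 2 + 4 * x) (2 * t) t := by
    simpa using (hasDerivAt_pow 2 t).add_const (4 * x)
  have hs : Real.sqrt (t ^ 2 + 4 * x) ≠ 0 := (Real.sqrt_pos.2 h).ne'
  refine (((hasDerivAt_id t).neg.add (hd.sqrt h.ne')).div_const 2).congr_deriv ?_
  field_simp

/-- `Ψ(x,t) = (−t + √(t²+4x))/2` satisfies `Ψ² + tΨ − x = 0` and solves
`∂Ψ/∂t = x·(∂Ψ/∂x)/Ψ − 1` for `0 < x < 1−t`, `0 < t < 1`; its `x`-derivative equals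
`1/√(t²+4x)`. -/
theorem stmt_8 :
    ∀ t ∈ Set.Ioo (0:ℝ) 1, ∀ x ∈ Set.Ioo (0:ℝ) (1 - t),
      (PsiSqrt x t) ^ 2 + t * PsiSqrt x t - x = 0 ∧
      deriv (fun s => PsiSqrt x s) t
          = x * deriv (fun y => PsiSqrt y t) x / PsiSqrt x t - 1 ∧
      deriv (fun y => PsiSqrt y t) x = 1 / Real.sqrt (t ^ 2 + 4 * x) := by
  intro t _ x hx
  have hx0 : 0 < x := hx.1
  have h : 0 < t ^ 2 + 4 * x := by positivity
  have hquad := PsiSqrt_sq_add_mul_sub h.le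
  refine ⟨hquad, ?_, (hasDerivAt_PsiSqrt_left h).deriv⟩
  rw [(hasDerivAt_PsiSqrt_left h).deriv, (hasDerivAt_PsiSqrt_right h).deriv]
  have hs : Real.sqrt (t ^ 2 + 4 * x) ≠ 0 := (Real.sqrt_pos.2 h).ne'
  have hΨ : PsiSqrt x t ≠ 0 := by
    intro h0
    rw [h0] at hquad
    linarith
  have hroot : Real.sqrt (t ^ 2 + 4 * x) = 2 * PsiSqrt x t + t := by
    unfold PsiSqrt
    ring
  rw [hroot] at hs ⊢
  field_simp
  linear_combination 2 * hquad
end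

section
/- Let 0 ≤ r₁ < r₂ < ∞. The function Ψ(x,t) := [x − (r₂−r₁)t − r₁ + √((r₁ + (r₂−r₁)t − x)² + 4t(r₂−r₁)x)] / (2(r₂−r₁)) solves the PDE ∂Ψ/∂t(x,t) = x·(∂Ψ/∂x)(x,t)/Ψ(x,t) − 1 for 0<t<1 and 0<x<(1−t)r₂. Its x-derivative equals ψ(x,t) = 1/(2(r₂−r₁)) + (x + (r₂−r₁)t − r₁) / (2(r₂−r₁)·√((r₁+(r₂−r₁)t−x)² + 4t(r₂−r₁)x)). -/
/-- The distribution function of the radial parts when the radial parts are initially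
uniform on the interval `[r₁, r₂]`. -/
noncomputable def PsiUnif (r₁ r₂ x t : ℝ) : ℝ :=
  (x - (r₂ - r₁) * t - r₁ +
      Real.sqrt ((r₁ + (r₂ - r₁) * t - x) ^ 2 + 4 * t * (r₂ - r₁) * x)) / (2 * (r₂ - r₁))

/-- The radicand of `PsiUnif` is positive when `t * (r₂ - r₁) * x` is. -/
theorem PsiUnif_radicand_pos {r₁ r₂ x t : ℝ} (hr : r₁ < r₂) (hx : 0 < x) (ht : 0 < t) :
    0 < (r₁ + (r₂ - r₁) * t - x) ^ 2 + 4 * t * (r₂ - r₁) * x := by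
  have hd : 0 < r₂ - r₁ := sub_pos.mpr hr
  positivity

theorem PsiUnif_pos {r₁ r₂ x t : ℝ} (hr : r₁ < r₂) (hx : 0 < x) (ht : 0 < t) :
    0 < PsiUnif r₁ r₂ x t := by
  have hd : 0 < r₂ - r₁ := sub_pos.mpr hr
  have hp : 0 < 4 * t * (r₂ - r₁) * x := by positivity
  have hlt : r₁ + (r₂ - r₁) * t - x <
      Real.sqrt ((r₁ + (r₂ - r₁) * t - x) ^ 2 + 4 * t * (r₂ - r₁) * x) :=
    Real.lt_sqrt_of_sq_lt (by linarith)
  exact div_pos (by linarith) (by linarith)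

theorem hasDerivAt_PsiUnif_left {r₁ r₂ x t : ℝ} (hr : r₁ < r₂) (hx : 0 < x) (ht : 0 < t) :
    HasDerivAt (fun y => PsiUnif r₁ r₂ y t)
      (1 / (2 * (r₂ - r₁)) + (x + (r₂ - r₁) * t - r₁) / (2 * (r₂ - r₁) *
        Real.sqrt ((r₁ + (r₂ - r₁) * t - x) ^ 2 + 4 * t * (r₂ - r₁) * x))) x := by
  have hQ := PsiUnif_radicand_pos hr hx ht
  have hd : r₂ - r₁ ≠ 0 := (sub_pos.mpr hr).ne'
  have hR := (Real.sqrt_pos.mpr hQ).ne'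
  have hid := hasDerivAt_id x
  have h := ((((hid.sub_const ((r₂ - r₁) * t)).sub_const r₁).add
    ((((hid.const_sub (r₁ + (r₂ - r₁) * t)).pow 2).add
      (hid.const_mul (4 * t * (r₂ - r₁)))).sqrt hQ.ne')).div_const (2 * (r₂ - r₁)))
  refine h.congr_deriv ?_
  simp only [Pi.add_apply, Pi.pow_apply, id_eq]
  field_simp
  ring

theorem hasDerivAt_PsiUnif_right {r₁ r₂ x t : ℝ} (hr : r₁ < r₂) (hx : 0 < x) (ht : 0 < t) :
    HasDerivAt (fun s => PsiUnif r₁ r₂ x s)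
      ((r₁ + (r₂ - r₁) * t + x) / (2 *
        Real.sqrt ((r₁ + (r₂ - r₁) * t - x) ^ 2 + 4 * t * (r₂ - r₁) * x)) - 1 / 2) t := by
  have hQ := PsiUnif_radicand_pos hr hx ht
  have hd : r₂ - r₁ ≠ 0 := (sub_pos.mpr hr).ne'
  have hR := (Real.sqrt_pos.mpr hQ).ne'
  have hid := hasDerivAt_id t
  have h := (((((hid.const_mul (r₂ - r₁)).const_sub x).sub_const r₁).add
    ((((((hid.const_mul (r₂ - r₁)).const_add r₁).sub_const x).pow 2).add
      (((hid.const_mul 4).mul_const (r₂ - r₁)).mul_const x)).sqrt hQ.ne')).div_const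
        (2 * (r₂ - r₁)))
  refine h.congr_deriv ?_
  simp only [Pi.add_apply, Pi.pow_apply, id_eq]
  field_simp
  ring

/-- For `0 ≤ r₁ < r₂`, the function `PsiUnif r₁ r₂` solves
`∂Ψ/∂t = x·(∂Ψ/∂x)/Ψ − 1` for `0 < t < 1`, `0 < x < (1−t)r₂`; its `x`-derivative equals
`1/(2(r₂−r₁)) + (x + (r₂−r₁)t − r₁)/(2(r₂−r₁)√((r₁+(r₂−r₁)t−x)² + 4t(r₂−r₁)x))`. -/
theorem stmt_9 (r₁ r₂ : ℝ) (hr₁ : 0 ≤ r₁) (hr₁₂ : r₁ < r₂) :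
    ∀ t ∈ Set.Ioo (0:ℝ) 1, ∀ x ∈ Set.Ioo (0:ℝ) ((1 - t) * r₂),
      deriv (fun s => PsiUnif r₁ r₂ x s) t
          = x * deriv (fun y => PsiUnif r₁ r₂ y t) x / PsiUnif r₁ r₂ x t - 1 ∧
      deriv (fun y => PsiUnif r₁ r₂ y t) x
          = 1 / (2 * (r₂ - r₁)) +
            (x + (r₂ - r₁) * t - r₁) /
              (2 * (r₂ - r₁) * Real.sqrt ((r₁ + (r₂ - r₁) * t - x) ^ 2 + 4 * t * (r₂ - r₁) * x)) := by
  intro t ht x hx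
  have hQ := PsiUnif_radicand_pos hr₁₂ hx.1 ht.1
  have hΨ := PsiUnif_pos hr₁₂ hx.1 ht.1
  have hX := (hasDerivAt_PsiUnif_left hr₁₂ hx.1 ht.1).deriv
  refine ⟨?_, hX⟩
  rw [hX, (hasDerivAt_PsiUnif_right hr₁₂ hx.1 ht.1).deriv]
  have hd : r₂ - r₁ ≠ 0 := (sub_pos.mpr hr₁₂).ne'
  have hR := (Real.sqrt_pos.mpr hQ).ne'
  have hsq := Real.sq_sqrt hQ.le
  rw [eq_sub_iff_add_eq, eq_div_iff hΨ.ne', PsiUnif]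
  generalize Real.sqrt _ = R at hR hsq ⊢
  field_simp
  linear_combination hsq
end

section
/- The function Ψ(x,t) := x(1−t)/(1+x) solves the PDE ∂Ψ/∂t(x,t) = x·(∂Ψ/∂x)(x,t)/Ψ(x,t) − 1 for all x>0 and 0<t<1. Its x-derivative equals ψ(x,t) = (1−t)/(1+x)², so the probability density ψ(x,t)/(1−t) is independent of t. -/
theorem hasDerivAt_mul_const_div_one_add (c : ℝ) {x : ℝ} (hx : 1 + x ≠ 0) :
    HasDerivAt (fun y => y * c / (1 + y)) (c / (1 + x) ^ 2) x := by
  refine (((hasDerivAt_id' x).mul_const c).fun_div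
    ((hasDerivAt_id' x).const_add 1) hx).congr_deriv ?_
  ring

theorem hasDerivAt_mul_one_sub_div (a b t : ℝ) :
    HasDerivAt (fun s => a * (1 - s) / b) (-a / b) t := by
  refine ((((hasDerivAt_id' t).const_sub 1).const_mul a).div_const b).congr_deriv ?_
  ring

/-- `Ψ(x,t) = x(1−t)/(1+x)` solves `∂Ψ/∂t = x·(∂Ψ/∂x)/Ψ − 1` for all
`x > 0` and `0 < t < 1`; its `x`-derivative equals `(1−t)/(1+x)²`, so the probability
density `ψ(x,t)/(1−t)` is independent of `t`. -/
theorem stmt_10 :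
    ∀ t ∈ Set.Ioo (0:ℝ) 1, ∀ x > (0:ℝ),
      deriv (fun s => x * (1 - s) / (1 + x)) t
          = x * deriv (fun y => y * (1 - t) / (1 + y)) x / (x * (1 - t) / (1 + x)) - 1 ∧
      deriv (fun y => y * (1 - t) / (1 + y)) x = (1 - t) / (1 + x) ^ 2 ∧
      (∀ t' ∈ Set.Ioo (0:ℝ) 1,
        deriv (fun y => y * (1 - t) / (1 + y)) x / (1 - t)
          = deriv (fun y => y * (1 - t') / (1 + y)) x / (1 - t')) := by
  intro t ht x hx
  have hx0 : x ≠ 0 := hx.ne'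
  have hx1 : 1 + x ≠ 0 := by positivity
  have ht1 : 1 - t ≠ 0 := (sub_pos.2 ht.2).ne'
  have hd (c : ℝ) := (hasDerivAt_mul_const_div_one_add c hx1).deriv
  refine ⟨?_, hd _, fun t' ht' => ?_⟩
  · rw [(hasDerivAt_mul_one_sub_div x (1 + x) t).deriv, hd]
    field_simp
    ring
  · have ht1' : 1 - t' ≠ 0 := (sub_pos.2 ht'.2).ne'
    rw [hd, hd]
    field_simp
end

section
/- Let C > 0 and let (Q_n)_{n∈ℕ} be monic polynomials with real coefficients all of whose roots lie in the interval [−C,0], such that the empirical root measures (1/n)·∑_{z: Q_n(z)=0} δ_z (roots counted with multiplicity) converge weakly to a finite measure μ₀ on [−C,0] of total mass m > 0. Let G₀(x) = ∫ μ₀(du)/(x−u) for x > 0, and for μ₀({0}) < y < m let w₀(y) > 0 be the unique solution of y = w₀(y)·G₀(w₀(y)). Then for every 0 ≤ t < m, the empirical root measures (1/n)·∑_{z: Q_n^{([tn])}(z)=0} δ_z of the [tn]-th derivatives converge weakly to a finite measure μ_t on [−C,0] of total mass m − t whose Cauchy–Stieltjes transform G_t(x) = ∫ μ_t(du)/(x−u)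 satisfies y = w_t(y)·G_t(w_t(y)) for all y with max(μ₀({0})−t, 0) < y < m−t, where w_t(y) := w₀(y+t)·y/(y+t). -/
open MeasureTheory Filter Polynomial

open scoped ENNReal

/-- The empirical measure of the roots (counted with multiplicity) of a real polynomial,
normalized by `1/n`. -/
noncomputable def empRootMeasure (n : ℕ) (p : Polynomial ℝ) : Measure ℝ :=
  ((n : ℝ≥0∞))⁻¹ • (p.roots.map Measure.dirac).sum

open Finset in
/-- If a nonnegative sequence decays geometrically from the index `J` on, its mean is at most
`J` plus a constant. -/
theorem sum_range_nat_mul_le_of_geometric_decay {c : ℕ → ℝ} (hc : ∀ j, 0 ≤ c j) {q : ℝ}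
    (hq : 0 ≤ q) (hq1 : q ≤ 1) {J : ℕ} (h : ∀ j, J ≤ j → c (j + 1) ≤ q * c j) (N : ℕ) :
    (1 - q) * (∑ j ∈ range (N + 1), j * c j - J * ∑ j ∈ range (N + 1), c j) ≤
      q * ∑ j ∈ range (N + 1), c j := by
  set T := ∑ j ∈ range (N + 1), c j with hT
  set S := ∑ j ∈ range (N + 1), ((j - J : ℕ) : ℝ) * c j with hS
  have hST : S ≤ q * (S + T) := by
    calc S = ∑ j ∈ range N, ((j + 1 - J : ℕ) : ℝ) * c (j + 1) := by
          rw [hS, sum_range_succ']; simp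
      _ ≤ ∑ j ∈ range N, q * ((((j - J : ℕ) : ℝ) + 1) * c j) := by
          refine sum_le_sum fun j _ => ?_
          rcases le_or_gt J j with hj | hj
          · have h1 := h j hj
            have h2 : ((j + 1 - J : ℕ) : ℝ) = ((j - J : ℕ) : ℝ) + 1 := by
              rw [Nat.sub_add_comm hj]; push_cast; ring
            rw [h2]
            calc _ ≤ (((j - J : ℕ) : ℝ) + 1) * (q * c j) := by gcongr
              _ = _ := by ring
          · rw [Nat.sub_eq_zero_of_le hj]
            have := hc j
            simp only [Nat.cast_zero, zero_mul]
            positivity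
      _ ≤ ∑ j ∈ range (N + 1), q * ((((j - J : ℕ) : ℝ) + 1) * c j) := by
          refine sum_le_sum_of_subset_of_nonneg (range_subset_range.2 (Nat.le_succ N)) ?_
          intro j _ _
          have := hc j
          positivity
      _ = q * (S + T) := by
          rw [← mul_sum, hS, hT, ← sum_add_distrib]
          congr 1
          exact sum_congr rfl fun j _ => by ring
  have hmean : ∑ j ∈ range (N + 1), j * c j ≤ J * T + S := by
    rw [hS, hT, mul_sum, ← sum_add_distrib]
    refine sum_le_sum fun j _ => ?_
    have : (j : ℝ) ≤ J + (j - J : ℕ) := by exact_mod_cast (by omega : j ≤ J + (j - J))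
    nlinarith [hc j]
  nlinarith

open Finset in
/-- If a nonnegative sequence grows geometrically up to the index `J`, its mean is at least
`J` minus a constant. -/
theorem le_sum_range_nat_mul_of_geometric_growth {c : ℕ → ℝ} (hc : ∀ j, 0 ≤ c j) {q : ℝ}
    (hq : 0 ≤ q) (hq1 : q ≤ 1) {J : ℕ} (h : ∀ j, j < J → c j ≤ q * c (j + 1)) {N : ℕ} (hN : J ≤ N) :
    (1 - q) * (J * ∑ j ∈ range (N + 1), c j - ∑ j ∈ range (N + 1), j * c j) ≤
      q * ∑ j ∈ range (N + 1), c j := by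
  set T := ∑ j ∈ range (N + 1), c j with hT
  set S := ∑ j ∈ range (N + 1), ((J - j : ℕ) : ℝ) * c j with hS
  have hST : S ≤ q * (S + T) := by
    calc S = ∑ j ∈ range N, ((J - j : ℕ) : ℝ) * c j := by
          rw [hS, sum_range_succ, Nat.sub_eq_zero_of_le hN]; simp
      _ ≤ ∑ j ∈ range N, q * ((((J - (j + 1) : ℕ) : ℝ) + 1) * c (j + 1)) := by
          refine sum_le_sum fun j _ => ?_
          rcases lt_or_ge j J with hj | hj
          · have h1 := h j hj
            have h2 : ((J - j : ℕ) : ℝ) = ((J - (j + 1) : ℕ) : ℝ) + 1 := by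
              exact_mod_cast (by omega : J - j = J - (j + 1) + 1)
            rw [h2]
            calc _ ≤ (((J - (j + 1) : ℕ) : ℝ) + 1) * (q * c (j + 1)) := by gcongr
              _ = _ := by ring
          · rw [Nat.sub_eq_zero_of_le hj]
            have := hc (j + 1)
            simp only [Nat.cast_zero, zero_mul]
            positivity
      _ ≤ ∑ j ∈ range (N + 1), q * ((((J - j : ℕ) : ℝ) + 1) * c j) := by
          rw [sum_range_succ' (fun j => q * ((((J - j : ℕ) : ℝ) + 1) * c j))]
          have := hc 0
          exact le_add_of_nonneg_right (by positivity)
      _ = q * (S + T) := by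
          rw [← mul_sum, hS, hT, ← sum_add_distrib]
          congr 1
          exact sum_congr rfl fun j _ => by ring
  have hmean : J * T ≤ ∑ j ∈ range (N + 1), j * c j + S := by
    rw [hS, hT, mul_sum, ← sum_add_distrib]
    refine sum_le_sum fun j _ => ?_
    have : (J : ℝ) ≤ j + (J - j : ℕ) := by exact_mod_cast (by omega : J ≤ j + (J - j))
    nlinarith [hc j]
  nlinarith

namespace Polynomial

theorem mul_eval_derivative_eq_sum_range (p : ℝ[X]) (x : ℝ) {N : ℕ} (hN : p.natDegree ≤ N) :
    x * (derivative p).eval x = ∑ j ∈ Finset.range (N + 1), j * (p.coeff j * x ^ j) := by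
  have h1 : x * (derivative p).eval x = (X * derivative p).eval x := by simp
  have hdeg : (X * derivative p).natDegree < N + 1 + 1 := by
    have := natDegree_mul_le (p := X) (q := derivative p)
    have := natDegree_derivative_le p
    have := natDegree_X_le (R := ℝ)
    omega
  rw [h1, eval_eq_sum_range' hdeg, Finset.sum_range_succ]
  have h0 : (X * derivative p).coeff (N + 1) = 0 := by
    rw [coeff_X_mul, coeff_derivative, coeff_eq_zero_of_natDegree_lt (by omega), zero_mul]
  rw [h0, zero_mul, add_zero]
  refine Finset.sum_congr rfl fun j _ => ?_
  rcases j with _ | j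
  · simp
  · rw [coeff_X_mul, coeff_derivative]; push_cast; ring

theorem mul_eval_derivative_le_of_coeff_ratio {p : ℝ[X]} (hp : ∀ j, 0 ≤ p.coeff j) {x s : ℝ}
    (hx : 0 < x) (hxs : x < s) {J : ℕ} (h : ∀ j, J ≤ j → s * p.coeff (j + 1) ≤ p.coeff j) :
    x * (derivative p).eval x ≤ (J + x / (s - x)) * p.eval x := by
  have hs : 0 < s := hx.trans hxs
  have key := sum_range_nat_mul_le_of_geometric_decay (c := fun j => p.coeff j * x ^ j)
    (fun j => mul_nonneg (hp j) (by positivity)) (q := x / s) (by positivity)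
    (div_le_one_of_le₀ hxs.le hs.le) (J := J)
    (fun j hj => by
      have := h j hj
      have h2 : x / s * (p.coeff j * x ^ j) = p.coeff j * (x ^ (j + 1) / s) := by ring
      rw [h2]
      calc p.coeff (j + 1) * x ^ (j + 1) = (s * p.coeff (j + 1)) * (x ^ (j + 1) / s) := by
            field_simp
        _ ≤ _ := by gcongr) p.natDegree
  rw [← mul_eval_derivative_eq_sum_range p x le_rfl, ← eval_eq_sum_range] at key
  have h1 : 1 - x / s = (s - x) / s := by field_simp
  have hsx : 0 < s - x := sub_pos.2 hxs
  rw [h1, div_mul_eq_mul_div, div_mul_eq_mul_div, div_le_div_iff_of_pos_right hs] at key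
  rw [add_mul, div_mul_eq_mul_div, ← sub_le_iff_le_add', le_div_iff₀ hsx]
  linarith

theorem le_mul_eval_derivative_of_coeff_ratio {p : ℝ[X]} (hp : ∀ j, 0 ≤ p.coeff j) {x s : ℝ}
    (hs : 0 ≤ s) (hsx : s < x) {J : ℕ} (h : ∀ j, j < J → p.coeff j ≤ s * p.coeff (j + 1)) :
    (J - s / (x - s)) * p.eval x ≤ x * (derivative p).eval x := by
  have hx : 0 < x := hs.trans_lt hsx
  have key := le_sum_range_nat_mul_of_geometric_growth (c := fun j => p.coeff j * x ^ j)
    (fun j => mul_nonneg (hp j) (by positivity)) (q := s / x) (by positivity)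
    (div_le_one_of_le₀ hsx.le hx.le) (J := J)
    (fun j hj => by
      have := h j hj
      have h2 : s / x * (p.coeff (j + 1) * x ^ (j + 1)) = s * p.coeff (j + 1) * x ^ j := by
        field_simp
        ring
      rw [h2]
      gcongr) (le_max_right p.natDegree J)
  have hdeg := le_max_left p.natDegree J
  rw [← mul_eval_derivative_eq_sum_range p x hdeg,
    ← eval_eq_sum_range' (Nat.lt_succ_of_le hdeg)] at key
  have h1 : 1 - s / x = (x - s) / x := by field_simp
  have hsx : 0 < x - s := sub_pos.2 hsx
  rw [h1, div_mul_eq_mul_div, div_mul_eq_mul_div, div_le_div_iff_of_pos_right hx] at key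
  rw [sub_mul, div_mul_eq_mul_div, sub_le_comm, le_div_iff₀ hsx]
  linarith

/-- The coefficients of a product of linear factors with nonpositive roots are nonnegative and
log-concave. -/
theorem coeff_prod_X_sub_C_nonneg_and_logConcave (s : Multiset ℝ) (hs : ∀ z ∈ s, z ≤ 0) :
    (∀ j, 0 ≤ (s.map fun z => X - C z).prod.coeff j) ∧
      ∀ i j, i ≤ j → (s.map fun z => X - C z).prod.coeff i *
        (s.map fun z => X - C z).prod.coeff (j + 1) ≤
          (s.map fun z => X - C z).prod.coeff (i + 1) *
            (s.map fun z => X - C z).prod.coeff j := by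
  induction s using Multiset.induction_on with
  | empty =>
    simp only [Multiset.map_zero, Multiset.prod_zero, coeff_one]
    refine ⟨fun j => by split_ifs <;> norm_num, fun i j _ => by simp⟩
  | cons z s ih =>
    obtain ⟨hnn, hlc⟩ := ih fun w hw => hs w (Multiset.mem_cons_of_mem hw)
    have hz : 0 ≤ -z := neg_nonneg.2 (hs z (Multiset.mem_cons_self z s))
    simp only [Multiset.map_cons, Multiset.prod_cons]
    set p := (s.map fun z => X - C z).prod
    set l := -z with hl
    have h0 : ((X - C z) * p).coeff 0 = l * p.coeff 0 := by
      simp [mul_coeff_zero, hl]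
    have hS : ∀ j, ((X - C z) * p).coeff (j + 1) = p.coeff j + l * p.coeff (j + 1) := by
      intro j
      rw [sub_mul, coeff_sub, coeff_X_mul, coeff_C_mul, hl]; ring
    refine ⟨fun j => ?_, fun i j hij => ?_⟩
    · rcases j with _ | j
      · rw [h0]; exact mul_nonneg hz (hnn 0)
      · rw [hS]; exact add_nonneg (hnn j) (mul_nonneg hz (hnn _))
    · rcases i with _ | i
      · rcases j with _ | j
        · simp only [zero_add]; rw [mul_comm]
        · simp only [h0, hS, zero_add]
          have h1 := mul_le_mul_of_nonneg_left (hlc 0 (j + 1) (Nat.zero_le _)) (mul_nonneg hz hz)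
          have h2 := mul_nonneg (hnn 0) (hnn j)
          have h3 := mul_nonneg hz (mul_nonneg (hnn 1) (hnn j))
          simp only [zero_add] at h1
          nlinarith
      · obtain ⟨j, rfl⟩ : ∃ j', j = j' + 1 := ⟨j - 1, by omega⟩
        simp only [hS]
        have hij' : i ≤ j := by omega
        have h1 := mul_le_mul_of_nonneg_left (hlc (i + 1) (j + 1) hij) (mul_nonneg hz hz)
        have h2 := hlc i j hij'
        have h3 : p.coeff i * p.coeff (j + 2) ≤ p.coeff (i + 2) * p.coeff j := by
          rcases hij'.eq_or_lt with rfl | hlt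
          · rw [mul_comm]
          · exact (hlc i (j + 1) (by omega)).trans (hlc (i + 1) j hlt)
        have h4 := mul_le_mul_of_nonneg_left h3 hz
        nlinarith

theorem coeff_ratio_dichotomy {p : ℝ[X]} (hmonic : p.Monic) (hp : ∀ j, 0 ≤ p.coeff j)
    (hlc : ∀ i j, i ≤ j → p.coeff i * p.coeff (j + 1) ≤ p.coeff (i + 1) * p.coeff j)
    {s : ℝ} (hs : 0 ≤ s) (j : ℕ) :
    (∀ i, j ≤ i → s * p.coeff (i + 1) ≤ p.coeff i) ∨
      ∀ i, i < j + 1 → p.coeff i ≤ s * p.coeff (i + 1) := by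
  rcases le_or_gt p.natDegree j with hj | hj
  · refine Or.inl fun i hi => ?_
    rw [coeff_eq_zero_of_natDegree_lt (by omega : p.natDegree < i + 1), mul_zero]
    exact hp i
  rcases le_or_gt (p.coeff j) (s * p.coeff (j + 1)) with h | h
  · refine Or.inr fun i hi => ?_
    have hi' : i ≤ j := by omega
    rcases (hp (j + 1)).eq_or_lt with h0 | h0
    · have hzero : ∀ l, l + 1 ≤ p.natDegree → p.coeff (l + 1) = 0 → p.coeff l = 0 := by
        intro l hl hl0
        have := hlc l (p.natDegree - 1) (by omega)
        rw [Nat.sub_add_cancel (by omega), hmonic.coeff_natDegree, hl0] at this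
        exact le_antisymm (by linarith) (hp l)
      have hall : p.coeff i = 0 := by
        refine Nat.decreasingInduction' (P := fun l => p.coeff l = 0) (fun l hl _ h' => ?_)
          (by omega : i ≤ j + 1) h0.symm
        exact hzero l (by omega) h'
      rw [hall]
      exact mul_nonneg hs (hp _)
    · have h1 := hlc i j hi'
      refine le_of_mul_le_mul_right ?_ h0
      nlinarith [hp (i + 1)]
  · refine Or.inl fun i hi => ?_
    have h0 : 0 < p.coeff j := (mul_nonneg hs (hp _)).trans_lt h
    refine le_of_mul_le_mul_left ?_ h0
    nlinarith [hlc j i hi, hp i]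

theorem div_mul_coeff_succ_iterate_derivative (p : ℝ[X]) (k i : ℕ) :
    (i + 1 : ℝ) / (i + 1 + k) * (derivative^[k] p).coeff (i + 1) =
      ((i + k).descFactorial k : ℝ) * p.coeff (i + 1 + k) := by
  have h := Nat.succ_descFactorial (i + k) k
  have h2 : i + k + 1 - k = i + 1 := by omega
  have h3 : i + k + 1 = i + 1 + k := by omega
  rw [h2, h3] at h
  have h' : (i + 1 : ℝ) * ((i + 1 + k).descFactorial k : ℝ) =
      (i + 1 + k : ℝ) * ((i + k).descFactorial k : ℝ) := by exact_mod_cast h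
  rw [coeff_iterate_derivative, nsmul_eq_mul, div_mul_eq_mul_div, div_eq_iff (by positivity)]
  linear_combination p.coeff (i + 1 + k) * h'

theorem coeff_iterate_derivative_nonneg {p : ℝ[X]} (hp : ∀ j, 0 ≤ p.coeff j) (k j : ℕ) :
    0 ≤ (derivative^[k] p).coeff j := by
  rw [coeff_iterate_derivative]
  exact nsmul_nonneg (hp _) _

theorem le_mul_eval_iterate_derivative_of_coeff_ratio {p : ℝ[X]} (hp : ∀ j, 0 ≤ p.coeff j)
    {r s x : ℝ} (hr : 0 ≤ r) {J k : ℕ} (h : ∀ i, i < J + k → p.coeff i ≤ r * p.coeff (i + 1))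
    (hrs : r * (J / (J + k)) ≤ s) (hsx : s < x) :
    (J - s / (x - s)) * (derivative^[k] p).eval x ≤ x * (derivative^[k + 1] p).eval x := by
  rw [Function.iterate_succ_apply']
  have hs : 0 ≤ s := le_trans (by positivity) hrs
  refine le_mul_eval_derivative_of_coeff_ratio (coeff_iterate_derivative_nonneg hp k) hs hsx
    fun i hi => ?_
  have h1 := h (i + k) (by omega)
  have h2 := div_mul_coeff_succ_iterate_derivative p k i
  have hb := coeff_iterate_derivative_nonneg hp k (i + 1)
  have hle : (i + 1 : ℝ) / (i + 1 + k) ≤ J / (J + k) := by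
    have hiJ : (i + 1 : ℝ) ≤ J := by exact_mod_cast hi
    have hk : (0 : ℝ) ≤ k := Nat.cast_nonneg k
    have hi0 : (0 : ℝ) ≤ i := Nat.cast_nonneg i
    rw [div_le_div_iff₀ (by positivity) (by linarith)]
    nlinarith
  calc (derivative^[k] p).coeff i = ((i + k).descFactorial k : ℝ) * p.coeff (i + k) := by
        rw [coeff_iterate_derivative, nsmul_eq_mul]
    _ ≤ ((i + k).descFactorial k : ℝ) * (r * p.coeff (i + k + 1)) := by gcongr
    _ = r * ((i + 1 : ℝ) / (i + 1 + k)) * (derivative^[k] p).coeff (i + 1) := by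
        rw [mul_assoc, h2, add_right_comm]; ring
    _ ≤ r * (J / (J + k)) * (derivative^[k] p).coeff (i + 1) := by gcongr
    _ ≤ _ := by gcongr

theorem mul_eval_iterate_derivative_le_of_coeff_ratio {p : ℝ[X]} (hp : ∀ j, 0 ≤ p.coeff j)
    {r s x : ℝ} (hr : 0 ≤ r) {J k : ℕ} (h : ∀ i, J + k ≤ i → r * p.coeff (i + 1) ≤ p.coeff i)
    (hrs : s ≤ r * (J / (J + k))) (hx : 0 < x) (hxs : x < s) :
    x * (derivative^[k + 1] p).eval x ≤ (J + x / (s - x)) * (derivative^[k] p).eval x := by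
  rw [Function.iterate_succ_apply']
  refine mul_eval_derivative_le_of_coeff_ratio (coeff_iterate_derivative_nonneg hp k) hx hxs
    fun i hi => ?_
  have h1 := h (i + k) (by omega)
  have h2 := div_mul_coeff_succ_iterate_derivative p k i
  have hb := coeff_iterate_derivative_nonneg hp k (i + 1)
  have hJ : (J / (J + k) : ℝ) ≤ (i + 1 : ℝ) / (i + 1 + k) := by
    have hiJ : (J : ℝ) ≤ i := by exact_mod_cast hi
    have hk : (0 : ℝ) ≤ k := Nat.cast_nonneg k
    rcases (by positivity : (0 : ℝ) ≤ J + k).eq_or_lt with h0 | h0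
    · rw [← h0, div_zero]; positivity
    rw [div_le_div_iff₀ h0 (by positivity)]
    nlinarith
  calc s * (derivative^[k] p).coeff (i + 1)
      ≤ r * (J / (J + k)) * (derivative^[k] p).coeff (i + 1) := by gcongr
    _ ≤ r * ((i + 1 : ℝ) / (i + 1 + k)) * (derivative^[k] p).coeff (i + 1) := by gcongr
    _ = ((i + k).descFactorial k : ℝ) * (r * p.coeff (i + k + 1)) := by
        rw [mul_assoc, h2, add_right_comm]; ring
    _ ≤ ((i + k).descFactorial k : ℝ) * p.coeff (i + k) := by gcongr
    _ = (derivative^[k] p).coeff i := by rw [coeff_iterate_derivative, nsmul_eq_mul]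

theorem eval_pos_of_coeff_nonneg {p : ℝ[X]} (hp0 : p ≠ 0) (hp : ∀ j, 0 ≤ p.coeff j) {x : ℝ}
    (hx : 0 < x) : 0 < p.eval x := by
  rw [eval_eq_sum_range]
  refine Finset.sum_pos' (fun j _ => mul_nonneg (hp j) (by positivity))
    ⟨p.natDegree, Finset.self_mem_range_succ _, mul_pos ?_ (by positivity)⟩
  exact lt_of_le_of_ne (hp _) fun h => hp0 (leadingCoeff_eq_zero.1 h.symm)

theorem iterate_derivative_ne_zero {p : ℝ[X]} (hp : p.Monic) {k : ℕ} (hk : k ≤ p.natDegree) :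
    derivative^[k] p ≠ 0 := by
  intro h
  have h1 := congrArg (fun q => coeff q (p.natDegree - k)) h
  simp only [coeff_iterate_derivative, Nat.sub_add_cancel hk, hp.coeff_natDegree, coeff_zero,
    nsmul_eq_mul, mul_one, Nat.cast_eq_zero, Nat.descFactorial_eq_zero_iff_lt] at h1
  omega

section Asymptotics

open scoped Topology

theorem eventually_coeff_le_mul_coeff_succ {Q : ℕ → ℝ[X]}
    (hmonic : ∀ n, (Q n).Monic) (hnn : ∀ n j, 0 ≤ (Q n).coeff j)
    (hlc : ∀ n i j, i ≤ j →
      (Q n).coeff i * (Q n).coeff (j + 1) ≤ (Q n).coeff (i + 1) * (Q n).coeff j)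
    {x r L y : ℝ} (hx : 0 < x) (hxr : x < r)
    (hL : Tendsto (fun n : ℕ => x * (derivative (Q n)).eval x / (n * (Q n).eval x)) atTop (𝓝 L))
    (hy : 0 ≤ y) (hyL : y < L) :
    ∀ᶠ n : ℕ in atTop, ∀ i, i < ⌊y * n⌋₊ + 1 → (Q n).coeff i ≤ r * (Q n).coeff (i + 1) := by
  have hlim : Tendsto (fun n : ℕ => y + x / (r - x) / n) atTop (𝓝 (y + 0)) :=
    tendsto_const_nhds.add (tendsto_const_div_atTop_nhds_zero_nat _)
  rw [add_zero] at hlim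
  filter_upwards [hlim.eventually_lt hL hyL, eventually_gt_atTop 0] with n hn hn0
  refine (coeff_ratio_dichotomy (hmonic n) (hnn n) (hlc n) (hx.trans hxr).le _).resolve_left
    fun hU => hn.not_ge ?_
  have hn0' : (0 : ℝ) < n := Nat.cast_pos.2 hn0
  have hpos := eval_pos_of_coeff_nonneg (hmonic n).ne_zero (hnn n) hx
  have hfl : (⌊y * n⌋₊ : ℝ) ≤ y * n := Nat.floor_le (by positivity)
  rw [div_le_iff₀ (by positivity)]
  calc _ ≤ (⌊y * n⌋₊ + x / (r - x)) * (Q n).eval x :=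
        mul_eval_derivative_le_of_coeff_ratio (hnn n) hx hxr hU
    _ ≤ (y * n + x / (r - x)) * (Q n).eval x := by gcongr
    _ = _ := by field_simp

theorem eventually_mul_coeff_succ_le_coeff {Q : ℕ → ℝ[X]}
    (hmonic : ∀ n, (Q n).Monic) (hnn : ∀ n j, 0 ≤ (Q n).coeff j)
    (hlc : ∀ n i j, i ≤ j →
      (Q n).coeff i * (Q n).coeff (j + 1) ≤ (Q n).coeff (i + 1) * (Q n).coeff j)
    {x r L y : ℝ} (hr : 0 ≤ r) (hrx : r < x)
    (hL : Tendsto (fun n : ℕ => x * (derivative (Q n)).eval x / (n * (Q n).eval x)) atTop (𝓝 L))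
    (hLy : L < y) :
    ∀ᶠ n : ℕ in atTop, ∀ i, ⌊y * n⌋₊ ≤ i → r * (Q n).coeff (i + 1) ≤ (Q n).coeff i := by
  have hlim : Tendsto (fun n : ℕ => y - r / (x - r) / n) atTop (𝓝 (y - 0)) :=
    tendsto_const_nhds.sub (tendsto_const_div_atTop_nhds_zero_nat _)
  rw [sub_zero] at hlim
  filter_upwards [hL.eventually_lt hlim hLy, eventually_gt_atTop 0] with n hn hn0
  refine (coeff_ratio_dichotomy (hmonic n) (hnn n) (hlc n) hr _).resolve_right
    fun hU => hn.not_ge ?_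
  have hn0' : (0 : ℝ) < n := Nat.cast_pos.2 hn0
  have hpos := eval_pos_of_coeff_nonneg (hmonic n).ne_zero (hnn n) (hr.trans_lt hrx)
  have hfl : y * n ≤ (⌊y * n⌋₊ + 1 : ℕ) := by push_cast; exact (Nat.lt_floor_add_one _).le
  rw [le_div_iff₀ (by positivity)]
  calc _ = (y * n - r / (x - r)) * (Q n).eval x := by field_simp
    _ ≤ ((⌊y * n⌋₊ + 1 : ℕ) - r / (x - r)) * (Q n).eval x := by gcongr
    _ ≤ _ := le_mul_eval_derivative_of_coeff_ratio (hnn n) hr hrx hU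

theorem tendsto_floor_mul_div {y : ℝ} (hy : 0 ≤ y) :
    Tendsto (fun n : ℕ => (⌊y * n⌋₊ : ℝ) / n) atTop (𝓝 y) :=
  (tendsto_nat_floor_mul_div_atTop hy).comp tendsto_natCast_atTop_atTop

/-- If `x / n` times the logarithmic derivative of `Q n` at `x` tends to `g x`, then
the same quantity for the `⌊t n⌋`-th derivatives, at the point `v (1 - t / g v)`, tends to `g v - t`. -/
theorem tendsto_logDeriv_iterate_derivative {Q : ℕ → ℝ[X]}
    (hmonic : ∀ n, (Q n).Monic) (hnn : ∀ n j, 0 ≤ (Q n).coeff j)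
    (hlc : ∀ n i j, i ≤ j →
      (Q n).coeff i * (Q n).coeff (j + 1) ≤ (Q n).coeff (i + 1) * (Q n).coeff j)
    {g : ℝ → ℝ} (hg : MonotoneOn g (Set.Ioi 0))
    (hgc : ContinuousOn g (Set.Ioi 0))
    (hL : ∀ x, 0 < x → Tendsto (fun n : ℕ => x * (derivative (Q n)).eval x / (n * (Q n).eval x))
      atTop (𝓝 (g x)))
    {t : ℝ} (ht : 0 ≤ t) (hdeg : ∀ᶠ n : ℕ in atTop, ⌊t * n⌋₊ ≤ (Q n).natDegree)
    {v x : ℝ} (hv : 0 < v) (htv : t < g v) (hx : x = v * ((g v - t) / g v)) :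
    Tendsto (fun n : ℕ => x * (derivative^[⌊t * n⌋₊ + 1] (Q n)).eval x /
      (n * (derivative^[⌊t * n⌋₊] (Q n)).eval x)) atTop (𝓝 (g v - t)) := by
  have hgv : 0 < g v := ht.trans_lt htv
  have hx0 : 0 < x := hx ▸ mul_pos hv (div_pos (sub_pos.2 htv) hgv)
  have hcont : ContinuousAt g v := hgc.continuousAt (Ioi_mem_nhds hv)
  have hpos : ∀ᶠ n : ℕ in atTop, 0 < n * (derivative^[⌊t * n⌋₊] (Q n)).eval x := by
    filter_upwards [hdeg, eventually_gt_atTop 0] with n hn hn0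
    exact mul_pos (Nat.cast_pos.2 hn0) (eval_pos_of_coeff_nonneg
      (iterate_derivative_ne_zero (hmonic n) hn) (coeff_iterate_derivative_nonneg (hnn n) _) hx0)
  have hdiff : ∀ {y : ℝ}, t < y → Tendsto
      (fun n : ℕ => ((⌊y * n⌋₊ : ℝ) - ⌊t * n⌋₊) / n) atTop (𝓝 (y - t)) := fun {y} hy => by
    simpa only [sub_div] using
      (tendsto_floor_mul_div (ht.trans hy.le)).sub (tendsto_floor_mul_div ht)
  have hone : Tendsto (fun n : ℕ => (1 : ℝ) / n) atTop (𝓝 0) :=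
    tendsto_const_div_atTop_nhds_zero_nat 1
  have hmono : ∀ {y y' : ℝ}, t < y → y ≤ y' → (y - t) / y ≤ (y' - t) / y' := by
    intro y y' hy hyy
    have h1 : 0 < y := ht.trans_lt hy
    rw [div_le_div_iff₀ h1 (h1.trans_le hyy)]
    nlinarith
  refine tendsto_order.2 ⟨fun z hz => ?_, fun z hz => ?_⟩
  · have hev : ∀ᶠ w in 𝓝[<] v, max (z + t) t < g w ∧ 0 < w ∧ w < v := by
      have h1 : ∀ᶠ w in 𝓝 v, max (z + t) t < g w :=
        hcont.eventually_const_lt (max_lt (by linarith) htv)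
      filter_upwards [h1.filter_mono nhdsWithin_le_nhds,
        (lt_mem_nhds hv).filter_mono nhdsWithin_le_nhds, self_mem_nhdsWithin] with w a b c
      exact ⟨a, b, c⟩
    obtain ⟨v₁, hgv₁, hv₁, hv₁v⟩ := hev.exists
    obtain ⟨y, hy, hyg⟩ := exists_between hgv₁
    obtain ⟨r, hr₁, hrv⟩ := exists_between hv₁v
    obtain ⟨hzy, hty⟩ := max_lt_iff.1 hy
    have hy0 : 0 < y := ht.trans_lt hty
    have hrx : r * ((y - t) / y) < x := by
      rw [hx]
      have hm := hmono hty (hyg.le.trans (hg hv₁ hv hv₁v.le))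
      have hp : 0 < (g v - t) / g v := div_pos (sub_pos.2 htv) hgv
      have hr0 : 0 < r := hv₁.trans hr₁
      calc _ ≤ r * ((g v - t) / g v) := by gcongr
        _ < _ := by gcongr
    obtain ⟨s, hrs, hsx⟩ := exists_between hrx
    have hJ : Tendsto (fun n : ℕ => ((⌊y * n⌋₊ : ℝ) + 1 - ⌊t * n⌋₊) / n) atTop (𝓝 (y - t)) := by
      have h := (hdiff hty).add hone
      rw [add_zero] at h
      exact h.congr fun n => by ring
    have hjk : Tendsto (fun n : ℕ => ((⌊y * n⌋₊ : ℝ) + 1) / n) atTop (𝓝 y) := by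
      simpa only [add_zero, ← add_div] using (tendsto_floor_mul_div hy0.le).add hone
    have hratio := (hJ.div hjk hy0.ne').const_mul r
    have hlow : Tendsto (fun n : ℕ => ((⌊y * n⌋₊ : ℝ) + 1 - ⌊t * n⌋₊) / n - s / (x - s) / n)
        atTop (𝓝 (y - t - 0)) := hJ.sub (tendsto_const_div_atTop_nhds_zero_nat _)
    filter_upwards [eventually_coeff_le_mul_coeff_succ hmonic hnn hlc hv₁ hr₁ (hL v₁ hv₁)
      hy0.le hyg, hratio.eventually_lt_const hrs,
      hlow.eventually_const_lt (by linarith : z < y - t - 0), hpos,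
      eventually_gt_atTop 0] with n hco hra hlo hpo hn0
    have hn0' : (0 : ℝ) < n := Nat.cast_pos.2 hn0
    have hfl : ⌊t * n⌋₊ ≤ ⌊y * n⌋₊ := Nat.floor_le_floor (by gcongr)
    obtain ⟨J, hJ'⟩ : ∃ J, J + ⌊t * n⌋₊ = ⌊y * n⌋₊ + 1 :=
      ⟨⌊y * n⌋₊ + 1 - ⌊t * n⌋₊, by omega⟩
    have hJR : (J : ℝ) + ⌊t * n⌋₊ = ⌊y * n⌋₊ + 1 := by exact_mod_cast hJ'
    rw [Pi.div_apply, div_div_div_cancel_right₀ hn0'.ne', ← hJR, add_sub_cancel_right] at hra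
    rw [← hJR, add_sub_cancel_right, ← sub_div] at hlo
    have key := le_mul_eval_iterate_derivative_of_coeff_ratio (hnn n) (hv₁.trans hr₁).le
      (by rwa [hJ']) hra.le hsx
    refine hlo.trans_le ?_
    rw [div_le_div_iff₀ hn0' hpo]
    calc _ = ((J - s / (x - s)) * (derivative^[⌊t * n⌋₊] (Q n)).eval x) * n := by ring
      _ ≤ _ := by gcongr
  · have hev : ∀ᶠ w in 𝓝[>] v, g w < z + t ∧ v < w := by
      have h1 : ∀ᶠ w in 𝓝 v, g w < z + t := hcont.eventually_lt_const (by linarith)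
      filter_upwards [h1.filter_mono nhdsWithin_le_nhds, self_mem_nhdsWithin] with w a b
      exact ⟨a, b⟩
    obtain ⟨v₁, hgv₁, hvv₁⟩ := hev.exists
    obtain ⟨y, hyg, hy⟩ := exists_between hgv₁
    obtain ⟨r, hvr, hr₁⟩ := exists_between hvv₁
    have hv₁ : 0 < v₁ := hv.trans hvv₁
    have hgg : g v ≤ g v₁ := hg hv hv₁ hvv₁.le
    have hty : t < y := by linarith
    have hy0 : 0 < y := ht.trans_lt hty
    have hrx : x < r * ((y - t) / y) := by
      rw [hx]
      have hm := hmono htv (hgg.trans hyg.le)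
      have hp : 0 < (g v - t) / g v := div_pos (sub_pos.2 htv) hgv
      have hr0 : 0 < r := hv.trans hvr
      calc _ < r * ((g v - t) / g v) := by gcongr
        _ ≤ _ := by gcongr
    obtain ⟨s, hxs, hsr⟩ := exists_between hrx
    have hJ := hdiff hty
    have hratio := (hJ.div (tendsto_floor_mul_div hy0.le) hy0.ne').const_mul r
    have hupp : Tendsto (fun n : ℕ => ((⌊y * n⌋₊ : ℝ) - ⌊t * n⌋₊) / n + x / (s - x) / n)
        atTop (𝓝 (y - t + 0)) := hJ.add (tendsto_const_div_atTop_nhds_zero_nat _)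
    filter_upwards [eventually_mul_coeff_succ_le_coeff hmonic hnn hlc (hv.trans hvr).le hr₁
      (hL v₁ hv₁) hyg, hratio.eventually_const_lt hsr,
      hupp.eventually_lt_const (by linarith : y - t + 0 < z), hpos,
      eventually_gt_atTop 0] with n hco hra hup hpo hn0
    have hn0' : (0 : ℝ) < n := Nat.cast_pos.2 hn0
    have hfl : ⌊t * n⌋₊ ≤ ⌊y * n⌋₊ := Nat.floor_le_floor (by gcongr)
    obtain ⟨J, hJ'⟩ : ∃ J, J + ⌊t * n⌋₊ = ⌊y * n⌋₊ := ⟨⌊y * n⌋₊ - ⌊t * n⌋₊, by omega⟩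
    have hJR : (J : ℝ) + ⌊t * n⌋₊ = ⌊y * n⌋₊ := by exact_mod_cast hJ'
    rw [Pi.div_apply, div_div_div_cancel_right₀ hn0'.ne', ← hJR, add_sub_cancel_right] at hra
    rw [← hJR, add_sub_cancel_right, ← add_div] at hup
    have key := mul_eval_iterate_derivative_le_of_coeff_ratio (hnn n) (hv.trans hvr).le
      (by rwa [hJ']) hra.le hx0 hxs
    refine lt_of_le_of_lt ?_ hup
    rw [div_le_div_iff₀ hpo hn0']
    calc _ ≤ ((J + x / (s - x)) * (derivative^[⌊t * n⌋₊] (Q n)).eval x) * n := by gcongr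
      _ = _ := by ring

end Asymptotics

end Polynomial

section Resolvent

variable {A : Type*} [NormedCommRing A] [NormedAlgebra ℝ A]

theorem Submodule.mem_of_hasDerivAt {V : Submodule ℝ A} (hV : IsClosed (V : Set A)) {f : ℝ → A}
    {f' : A} {x : ℝ} (hf : HasDerivAt f f' x) (h : ∀ᶠ y in nhds x, f y ∈ V) : f' ∈ V := by
  refine hV.mem_of_tendsto (hasDerivAt_iff_tendsto_slope.1 hf) ?_
  filter_upwards [h.filter_mono nhdsWithin_le_nhds] with y hy
  exact V.smul_mem _ (V.sub_mem hy h.self_of_nhds)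

/-- A closed subspace containing `1` and the resolvents of `a` at all points of an open set
contains the powers of these resolvents. -/
theorem Submodule.resolvent_pow_mem [CompleteSpace A] {V : Submodule ℝ A} (hV : IsClosed (V : Set A))
    (hone : (1 : A) ∈ V) {a : A} {U : Set ℝ} (hU : IsOpen U) (hUa : U ⊆ resolventSet ℝ a)
    (h : ∀ x ∈ U, resolvent a x ∈ V) (n : ℕ) : ∀ x ∈ U, resolvent a x ^ n ∈ V := by
  induction n using Nat.twoStepInduction with
  | zero => exact fun x _ => by simpa using hone
  | one => simpa using h
  | more n _ ih =>
    intro x hx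
    have hd := (spectrum.hasDerivAt_resolvent_const_left (hUa hx)).fun_pow (n + 1)
    have hmem := V.mem_of_hasDerivAt hV hd (by filter_upwards [hU.mem_nhds hx] using ih)
    have hn : (-((n + 1 : ℕ) : ℝ)) ≠ 0 := neg_ne_zero.2 (Nat.cast_ne_zero.2 n.succ_ne_zero)
    have heq : (((n + 1 : ℕ) : A) * resolvent a x ^ (n + 1 - 1) * -resolvent a x ^ 2) =
        (-((n + 1 : ℕ) : ℝ)) • resolvent a x ^ (n + 2) := by
      rw [Nat.add_sub_cancel, neg_smul, Nat.cast_smul_eq_nsmul, nsmul_eq_mul]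
      ring
    rw [heq] at hmem
    exact (V.smul_mem_iff hn).1 hmem

end Resolvent

section CauchyTransform

open scoped Topology NNReal

/-- The coordinate function on a compact interval. -/
def ContinuousMap.coordIcc (c d : ℝ) : C(Set.Icc c d, ℝ) := ⟨Subtype.val, continuous_subtype_val⟩

theorem ContinuousMap.mem_resolventSet_coordIcc {c d x : ℝ} (hx : d < x) :
    x ∈ resolventSet ℝ (ContinuousMap.coordIcc c d) := by
  rw [spectrum.mem_resolventSet_iff, ContinuousMap.isUnit_iff_forall_ne_zero]
  intro u
  exact (sub_pos.2 (u.2.2.trans_lt hx)).ne'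

theorem ContinuousMap.resolvent_coordIcc_apply {c d x : ℝ} (hx : d < x) (u : Set.Icc c d) :
    resolvent (ContinuousMap.coordIcc c d) x u = (x - u)⁻¹ := by
  have h := congrArg (fun f : C(Set.Icc c d, ℝ) => f u)
    (Ring.inverse_mul_cancel _ (ContinuousMap.mem_resolventSet_coordIcc (c := c) hx))
  exact eq_inv_of_mul_eq_one_left h

/-- A closed subspace of `C([c, d])` containing `1` and the Cauchy kernels `u ↦ (x - u)⁻¹` for
`x` in an open interval to the right of `d` is everything. -/
theorem Submodule.eq_top_of_resolvent_coordIcc_mem {c d a b : ℝ} (hda : d ≤ a) (hab : a < b)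
    {V : Submodule ℝ C(Set.Icc c d, ℝ)} (hV : IsClosed (V : Set C(Set.Icc c d, ℝ)))
    (hone : (1 : C(Set.Icc c d, ℝ)) ∈ V)
    (h : ∀ x ∈ Set.Ioo a b, resolvent (ContinuousMap.coordIcc c d) x ∈ V) : V = ⊤ := by
  obtain ⟨x, hx⟩ := Set.nonempty_Ioo.2 hab
  set R := resolvent (ContinuousMap.coordIcc c d) x with hR
  have hpow : ∀ n, R ^ n ∈ V := fun n => V.resolvent_pow_mem hV hone isOpen_Ioo
    (fun y hy => ContinuousMap.mem_resolventSet_coordIcc (hda.trans_lt hy.1)) h n x hx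
  have hsub : (Algebra.adjoin ℝ {R} : Set C(Set.Icc c d, ℝ)) ⊆ V := by
    intro f hf
    rw [SetLike.mem_coe, Algebra.adjoin_singleton_eq_range_aeval] at hf
    obtain ⟨p, rfl⟩ := hf
    change aeval R p ∈ V
    rw [aeval_eq_sum_range]
    exact V.sum_mem fun i _ => V.smul_mem _ (hpow i)
  have hdense := ContinuousMap.subalgebra_topologicalClosure_eq_top_of_separatesPoints
    (Algebra.adjoin ℝ {R}) (by
      intro u w huw
      refine ⟨R, ⟨R, Algebra.subset_adjoin rfl, rfl⟩, fun heq => huw ?_⟩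
      rw [hR, ContinuousMap.resolvent_coordIcc_apply (hda.trans_lt hx.1),
        ContinuousMap.resolvent_coordIcc_apply (hda.trans_lt hx.1), inv_inj] at heq
      exact Subtype.ext (by linarith))
  refine eq_top_iff.2 fun f _ => closure_minimal hsub hV ?_
  have : f ∈ (Algebra.adjoin ℝ {R}).topologicalClosure := hdense ▸ Algebra.mem_top
  exact this

/-- The extension of a continuous function on `[c, d]` by its boundary values. -/
noncomputable def ContinuousMap.extendIcc {c d : ℝ} (hcd : c ≤ d) (f : C(Set.Icc c d, ℝ)) :
    BoundedContinuousFunction ℝ ℝ :=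
  (BoundedContinuousFunction.mkOfCompact f).compContinuous
    ⟨Set.projIcc c d hcd, continuous_projIcc⟩

theorem ContinuousMap.extendIcc_apply {c d : ℝ} (hcd : c ≤ d) (f : C(Set.Icc c d, ℝ)) (u : ℝ) :
    f.extendIcc hcd u = f (Set.projIcc c d hcd u) := rfl

theorem ContinuousMap.norm_extendIcc_le {c d : ℝ} (hcd : c ≤ d) (f : C(Set.Icc c d, ℝ)) :
    ‖f.extendIcc hcd‖ ≤ ‖f‖ :=
  (BoundedContinuousFunction.norm_le (norm_nonneg f)).2 fun _ => f.norm_coe_le_norm _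

theorem MeasureTheory.ae_mem_Icc_of_compl_eq_zero {c d : ℝ} {μ : Measure ℝ}
    (h : μ (Set.Icc c d)ᶜ = 0) : ∀ᵐ u ∂μ, u ∈ Set.Icc c d := mem_ae_iff.2 h

theorem extendIcc_resolvent_coordIcc_ae_eq {c d x : ℝ} (hcd : c ≤ d) (hx : d < x)
    {μ : Measure ℝ} (hμ : μ (Set.Icc c d)ᶜ = 0) :
    (resolvent (ContinuousMap.coordIcc c d) x).extendIcc hcd =ᵐ[μ] fun u => (x - u)⁻¹ := by
  filter_upwards [ae_mem_Icc_of_compl_eq_zero hμ] with u hu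
  rw [ContinuousMap.extendIcc_apply, ContinuousMap.resolvent_coordIcc_apply hx,
    Set.projIcc_of_mem hcd hu]

theorem integral_extendIcc_resolvent_coordIcc {c d x : ℝ} (hcd : c ≤ d) (hx : d < x)
    {μ : Measure ℝ} (hμ : μ (Set.Icc c d)ᶜ = 0) :
    ∫ u, (resolvent (ContinuousMap.coordIcc c d) x).extendIcc hcd u ∂μ = ∫ u, (x - u)⁻¹ ∂μ :=
  integral_congr_ae (extendIcc_resolvent_coordIcc_ae_eq hcd hx hμ)

theorem integrable_inv_sub {c d x : ℝ} (hcd : c ≤ d) (hx : d < x) {μ : Measure ℝ}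
    [IsFiniteMeasure μ] (hμ : μ (Set.Icc c d)ᶜ = 0) : Integrable (fun u => (x - u)⁻¹) μ :=
  (BoundedContinuousFunction.integrable μ _).congr (extendIcc_resolvent_coordIcc_ae_eq hcd hx hμ)

/-- If the masses and the Cauchy transforms on an open interval converge, then the measures
converge weakly. -/
theorem exists_tendsto_of_tendsto_cauchyTransform {c d a b : ℝ} (hcd : c ≤ d) (hda : d ≤ a)
    (hab : a < b) (ν : ℕ → FiniteMeasure ℝ) {M : ℝ≥0}
    (hM : Tendsto (fun n => (ν n).mass) atTop (𝓝 M))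
    (hsupp : ∀ n, (ν n : Measure ℝ) (Set.Icc c d)ᶜ = 0)
    (h : ∀ x ∈ Set.Ioo a b, ∃ l, Tendsto (fun n => ∫ u, (x - u)⁻¹ ∂(ν n : Measure ℝ)) atTop (𝓝 l)) :
    ∃ μ : FiniteMeasure ℝ, (μ : Measure ℝ) (Set.Icc c d)ᶜ = 0 ∧ Tendsto ν atTop (𝓝 μ) := by
  have hcomp := isCompact_setOfPred_finiteMeasure_le_of_isCompact (E := ℝ) (M + 1)
    (isCompact_Icc (a := c) (b := d))
  have hbound : ∀ᶠ n in atTop, (ν n).mass ≤ M + 1 := hM.eventually_le_const (by simp)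
  let U : Ultrafilter ℕ := Ultrafilter.of atTop
  have hU : (U : Filter ℕ) ≤ atTop := Ultrafilter.of_le atTop
  obtain ⟨μ, ⟨-, hμs⟩, hμ⟩ := hcomp.ultrafilter_le_nhds (U.map ν) (by
    rw [le_principal_iff]
    change ∀ᶠ n in (U : Filter ℕ), (ν n).mass ≤ M + 1 ∧ ν n (Set.Icc c d)ᶜ = 0
    filter_upwards [hbound.filter_mono hU] with n hn
    exact ⟨hn, (FiniteMeasure.null_iff_toMeasure_null _ _).2 (hsupp n)⟩)
  have hμs' : (μ : Measure ℝ) (Set.Icc c d)ᶜ = 0 := (FiniteMeasure.null_iff_toMeasure_null _ _).1 hμs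
  have hμU : Tendsto ν U (𝓝 μ) := hμ
  have hUint := FiniteMeasure.tendsto_iff_forall_integral_tendsto.1 hμU
  let V : Submodule ℝ C(Set.Icc c d, ℝ) :=
    { carrier := {f | Tendsto (fun n => ∫ u, f.extendIcc hcd u ∂(ν n : Measure ℝ)) atTop
        (𝓝 (∫ u, f.extendIcc hcd u ∂(μ : Measure ℝ)))}
      add_mem' := fun {f g} hf hg => by
        have hadd : ∀ ρ : FiniteMeasure ℝ, ∫ u, (f + g).extendIcc hcd u ∂(ρ : Measure ℝ) =
            ∫ u, f.extendIcc hcd u ∂(ρ : Measure ℝ) + ∫ u, g.extendIcc hcd u ∂(ρ : Measure ℝ) :=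
          fun ρ => integral_add ((f.extendIcc hcd).integrable _) ((g.extendIcc hcd).integrable _)
        simp only [Set.mem_ofPred_eq, hadd] at hf hg ⊢
        exact hf.add hg
      zero_mem' := by
        have hzero : ∀ u, (0 : C(Set.Icc c d, ℝ)).extendIcc hcd u = 0 := fun _ => rfl
        simp only [Set.mem_ofPred_eq, hzero, integral_zero]
        exact tendsto_const_nhds
      smul_mem' := fun r f hf => by
        have hsmul : ∀ ρ : FiniteMeasure ℝ, ∫ u, (r • f).extendIcc hcd u ∂(ρ : Measure ℝ) =
            r • ∫ u, f.extendIcc hcd u ∂(ρ : Measure ℝ) :=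
          fun ρ => integral_smul r _
        simp only [Set.mem_ofPred_eq, hsmul] at hf ⊢
        exact hf.const_smul r }
  have hVc : IsClosed (V : Set C(Set.Icc c d, ℝ)) := by
    refine isClosed_of_closure_subset fun f hf => ?_
    have hsub : ∀ (g : C(Set.Icc c d, ℝ)) (ρ : FiniteMeasure ℝ),
        dist (∫ u, f.extendIcc hcd u ∂(ρ : Measure ℝ)) (∫ u, g.extendIcc hcd u ∂(ρ : Measure ℝ)) ≤
          ρ.mass * ‖f - g‖ := by
      intro g ρ
      rw [dist_eq_norm, ← integral_sub ((f.extendIcc hcd).integrable _)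
        ((g.extendIcc hcd).integrable _)]
      refine ((f - g).extendIcc hcd).norm_integral_le_mul_norm (μ := (ρ : Measure ℝ)) |>.trans ?_
      exact mul_le_mul_of_nonneg_left ((f - g).norm_extendIcc_le hcd) ρ.mass.2
    refine Metric.tendsto_nhds.2 fun ε hε => ?_
    have hδ : 0 < ε / (3 * (M + 1 + μ.mass)) := by positivity
    obtain ⟨g, hg, hfg⟩ := Metric.mem_closure_iff.1 hf _ hδ
    rw [dist_eq_norm, lt_div_iff₀ (by positivity)] at hfg
    filter_upwards [Metric.tendsto_nhds.1 hg (ε / 3) (by positivity), hbound] with n hn hb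
    have hb' : ((ν n).mass : ℝ) ≤ M + 1 := by exact_mod_cast hb
    have h1 := hsub g (ν n)
    have h2 := hsub g μ
    rw [dist_comm] at h2
    have h3 : ((ν n).mass : ℝ) * ‖f - g‖ ≤ (M + 1) * ‖f - g‖ := by gcongr
    have h4 : 0 ≤ (μ.mass : ℝ) * ‖f - g‖ := by positivity
    have h5 : 0 ≤ (M + 1 : ℝ) * ‖f - g‖ := by positivity
    have h6 := dist_triangle4 (∫ u, f.extendIcc hcd u ∂(ν n : Measure ℝ))
      (∫ u, g.extendIcc hcd u ∂(ν n : Measure ℝ)) (∫ u, g.extendIcc hcd u ∂(μ : Measure ℝ))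
      (∫ u, f.extendIcc hcd u ∂(μ : Measure ℝ))
    linarith
  have hVone : (1 : C(Set.Icc c d, ℝ)) ∈ V := by
    have hint : ∀ ρ : FiniteMeasure ℝ,
        ∫ u, (1 : C(Set.Icc c d, ℝ)).extendIcc hcd u ∂(ρ : Measure ℝ) = ρ.mass := by
      intro ρ
      have : ∀ u, (1 : C(Set.Icc c d, ℝ)).extendIcc hcd u = 1 := fun _ => rfl
      simp only [this, integral_const, smul_eq_mul, mul_one]
      rfl
    have hm : Tendsto (fun n => ((ν n).mass : ℝ)) atTop (𝓝 M) :=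
      (NNReal.continuous_coe.tendsto M).comp hM
    have hmU := hUint ((1 : C(Set.Icc c d, ℝ)).extendIcc hcd)
    have hgoal : Tendsto (fun n => ∫ u, (1 : C(Set.Icc c d, ℝ)).extendIcc hcd u ∂(ν n : Measure ℝ))
        atTop (𝓝 (∫ u, (1 : C(Set.Icc c d, ℝ)).extendIcc hcd u ∂(μ : Measure ℝ))) := by
      simp only [hint] at hmU ⊢
      exact tendsto_nhds_unique hmU (hm.mono_left hU) ▸ hm
    exact hgoal
  have hVres : ∀ x ∈ Set.Ioo a b, resolvent (ContinuousMap.coordIcc c d) x ∈ V := by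
    intro x hx
    obtain ⟨l, hl⟩ := h x hx
    have hxU := hUint ((resolvent (ContinuousMap.coordIcc c d) x).extendIcc hcd)
    have hgoal : Tendsto (fun n => ∫ u, (resolvent (ContinuousMap.coordIcc c d) x).extendIcc hcd u
        ∂(ν n : Measure ℝ)) atTop
        (𝓝 (∫ u, (resolvent (ContinuousMap.coordIcc c d) x).extendIcc hcd u ∂(μ : Measure ℝ))) := by
      simp only [integral_extendIcc_resolvent_coordIcc hcd (hda.trans_lt hx.1) (hsupp _),
        integral_extendIcc_resolvent_coordIcc hcd (hda.trans_lt hx.1) hμs'] at hxU ⊢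
      exact tendsto_nhds_unique hxU (hl.mono_left hU) ▸ hl
    exact hgoal
  have hVtop := V.eq_top_of_resolvent_coordIcc_mem hda hab hVc hVone hVres
  refine ⟨μ, hμs', FiniteMeasure.tendsto_iff_forall_integral_tendsto.2 fun f => ?_⟩
  have hfV : f.toContinuousMap.restrict (Set.Icc c d) ∈ V := hVtop ▸ Submodule.mem_top
  have hint : ∀ ρ : FiniteMeasure ℝ, (ρ : Measure ℝ) (Set.Icc c d)ᶜ = 0 →
      ∫ u, (f.toContinuousMap.restrict (Set.Icc c d)).extendIcc hcd u ∂(ρ : Measure ℝ) =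
        ∫ u, f u ∂(ρ : Measure ℝ) := by
    intro ρ hρ
    refine integral_congr_ae ?_
    filter_upwards [ae_mem_Icc_of_compl_eq_zero hρ] with u hu
    rw [ContinuousMap.extendIcc_apply, Set.projIcc_of_mem hcd hu]
    rfl
  have hfV' : Tendsto (fun n => ∫ u, (f.toContinuousMap.restrict (Set.Icc c d)).extendIcc hcd u
      ∂(ν n : Measure ℝ)) atTop (𝓝 (∫ u, (f.toContinuousMap.restrict (Set.Icc c d)).extendIcc hcd u
        ∂(μ : Measure ℝ))) := hfV
  simpa only [hint _ (hsupp _), hint _ hμs'] using hfV'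

theorem monotoneOn_mul_integral_inv_sub {c : ℝ} (hc : c ≤ 0) {μ : Measure ℝ} [IsFiniteMeasure μ]
    (hμ : μ (Set.Icc c 0)ᶜ = 0) : MonotoneOn (fun x => x * ∫ u, (x - u)⁻¹ ∂μ) (Set.Ioi 0) := by
  intro x hx y hy hxy
  simp only [← integral_const_mul]
  refine integral_mono_ae ((integrable_inv_sub hc hx hμ).const_mul x)
    ((integrable_inv_sub hc hy hμ).const_mul y) ?_
  filter_upwards [ae_mem_Icc_of_compl_eq_zero hμ] with u hu
  have h1 : 0 < x - u := sub_pos.2 (hu.2.trans_lt hx)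
  have h2 : 0 < y - u := sub_pos.2 (hu.2.trans_lt hy)
  simp only [← div_eq_mul_inv]
  rw [div_le_div_iff₀ h1 h2]
  nlinarith [hu.2]

theorem continuousOn_integral_inv_sub {c : ℝ} {μ : Measure ℝ} [IsFiniteMeasure μ]
    (hμ : μ (Set.Icc c 0)ᶜ = 0) : ContinuousOn (fun x => ∫ u, (x - u)⁻¹ ∂μ) (Set.Ioi 0) := by
  intro x hx
  have hx0 : (0 : ℝ) < x := hx
  refine ContinuousAt.continuousWithinAt ?_
  refine continuousAt_of_dominated (bound := fun _ => (x / 2)⁻¹)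
    (Eventually.of_forall fun y => by fun_prop) ?_ (integrable_const _) ?_
  · filter_upwards [lt_mem_nhds (half_lt_self hx0)] with y hy
    filter_upwards [ae_mem_Icc_of_compl_eq_zero hμ] with u hu
    have h1 : x / 2 ≤ y - u := by linarith [hu.2]
    rw [norm_inv, Real.norm_of_nonneg (by linarith)]
    gcongr
  · filter_upwards [ae_mem_Icc_of_compl_eq_zero hμ] with u hu
    exact ContinuousAt.inv₀ (by fun_prop) (sub_pos.2 (hu.2.trans_lt hx0)).ne'

theorem div_add_mul_le_mul_integral_inv_sub {C x : ℝ} (hC : 0 ≤ C) (hx : 0 < x) {μ : Measure ℝ}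
    [IsFiniteMeasure μ] (hμ : μ (Set.Icc (-C) 0)ᶜ = 0) :
    x / (x + C) * μ.real Set.univ ≤ x * ∫ u, (x - u)⁻¹ ∂μ := by
  rw [← integral_const_mul, mul_comm (x / (x + C)), ← smul_eq_mul, ← integral_const]
  refine integral_mono_ae (integrable_const _)
    ((integrable_inv_sub (neg_nonpos.2 hC) hx hμ).const_mul x) ?_
  filter_upwards [ae_mem_Icc_of_compl_eq_zero hμ] with u hu
  have h1 : 0 < x - u := sub_pos.2 (hu.2.trans_lt hx)
  have h2 : x - u ≤ x + C := by linarith [hu.1]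
  simp only [← div_eq_mul_inv]
  gcongr

end CauchyTransform

section RootMeasure

theorem integrable_and_integral_sum_map_dirac (s : Multiset ℝ) (f : ℝ → ℝ) :
    Integrable f (s.map Measure.dirac).sum ∧
      ∫ u, f u ∂(s.map Measure.dirac).sum = (s.map f).sum := by
  induction s using Multiset.induction_on with
  | empty => simp
  | cons a s ih =>
    have ha : Integrable f (Measure.dirac a) := integrable_dirac (by simp)
    simp only [Multiset.map_cons, Multiset.sum_cons]
    exact ⟨ha.add_measure ih.1, by rw [integral_add_measure ha ih.1, integral_dirac, ih.2]⟩

theorem sum_map_dirac_apply_univ (s : Multiset ℝ) :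
    (s.map Measure.dirac).sum Set.univ = s.card := by
  induction s using Multiset.induction_on with
  | empty => simp
  | cons a s ih => simp [ih, add_comm]

theorem sum_map_dirac_apply_eq_zero {s : Multiset ℝ} {t : Set ℝ} (ht : MeasurableSet t)
    (h : ∀ z ∈ s, z ∉ t) : (s.map Measure.dirac).sum t = 0 := by
  induction s using Multiset.induction_on with
  | empty => simp
  | cons a s ih =>
    simp [ih fun z hz => h z (Multiset.mem_cons_of_mem hz), ht, h a (Multiset.mem_cons_self a s)]

theorem integral_empRootMeasure (n : ℕ) (p : ℝ[X]) (f : ℝ → ℝ) :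
    ∫ u, f u ∂(empRootMeasure n p) = (n : ℝ)⁻¹ * (p.roots.map f).sum := by
  rw [empRootMeasure, integral_smul_measure, (integrable_and_integral_sum_map_dirac _ _).2]
  simp

theorem empRootMeasure_apply_univ (n : ℕ) (p : ℝ[X]) :
    empRootMeasure n p Set.univ = (n : ℝ≥0∞)⁻¹ * p.roots.card := by
  rw [empRootMeasure, Measure.smul_apply, sum_map_dirac_apply_univ, smul_eq_mul]

theorem isFiniteMeasure_empRootMeasure {n : ℕ} (hn : n ≠ 0) (p : ℝ[X]) :
    IsFiniteMeasure (empRootMeasure n p) := by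
  refine ⟨?_⟩
  rw [empRootMeasure_apply_univ]
  exact ENNReal.mul_lt_top (by simp [hn, pos_iff_ne_zero]) (by simp)

theorem empRootMeasure_apply_eq_zero {n : ℕ} {p : ℝ[X]} {t : Set ℝ} (ht : MeasurableSet t)
    (h : ∀ z ∈ p.roots, z ∉ t) : empRootMeasure n p t = 0 := by
  rw [empRootMeasure, Measure.smul_apply, sum_map_dirac_apply_eq_zero ht h, smul_zero]

theorem mul_integral_inv_sub_empRootMeasure (n : ℕ) {p : ℝ[X]} (hp : p.Splits) {x : ℝ}
    (hx : p.eval x ≠ 0) :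
    x * ∫ u, (x - u)⁻¹ ∂(empRootMeasure n p) = x * (derivative p).eval x / (n * p.eval x) := by
  have h := hp.eval_derivative_div_eval_of_ne_zero hx
  simp only [one_div] at h
  rw [integral_empRootMeasure, ← h]
  ring

namespace Polynomial

theorem Splits.derivative_real {p : ℝ[X]} (hp : p.Splits) : (derivative p).Splits := by
  rw [splits_iff_card_roots] at hp ⊢
  have h1 := card_roots_le_derivative p
  have h2 := card_roots' (derivative p)
  have h3 := natDegree_derivative_le p
  rcases eq_or_ne p.natDegree 0 with h0 | h0
  · rw [derivative_of_natDegree_zero h0]; simp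
  · omega

theorem mem_Icc_of_mem_roots_derivative {p : ℝ[X]} (hp : p.Splits) {c d : ℝ}
    (h : ∀ z ∈ p.roots, z ∈ Set.Icc c d) : ∀ z ∈ (derivative p).roots, z ∈ Set.Icc c d := by
  intro z hz
  obtain ⟨hd0, hz0⟩ := mem_roots'.1 hz
  have hp0 : p ≠ 0 := by rintro rfl; simp at hd0
  by_cases hpz : p.eval z = 0
  · exact h z ((mem_roots hp0).2 hpz)
  have hsum := hp.eval_derivative_div_eval_of_ne_zero hpz
  rw [hz0.eq_zero, zero_div] at hsum
  have hne : p.roots ≠ ∅ := by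
    intro h0
    have hcard := splits_iff_card_roots.1 hp
    rw [h0] at hcard
    exact hd0 (derivative_of_natDegree_zero hcard.symm)
  by_contra hzc
  rw [Set.mem_Icc, not_and_or, not_le, not_le] at hzc
  rcases hzc with hzc | hzc
  · have := Multiset.sum_lt_sum_of_nonempty (f := fun w => 1 / (z - w)) (g := fun _ => 0) hne
      fun w hw => one_div_neg.2 (by linarith [(h w hw).1])
    rw [← hsum] at this
    simp at this
  · have := Multiset.sum_lt_sum_of_nonempty (f := fun _ => 0) (g := fun w => 1 / (z - w)) hne
      fun w hw => one_div_pos.2 (by linarith [(h w hw).2])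
    rw [← hsum] at this
    simp at this

theorem splits_and_roots_iterate_derivative {p : ℝ[X]} (hp : p.Splits) {c d : ℝ}
    (h : ∀ z ∈ p.roots, z ∈ Set.Icc c d) (k : ℕ) :
    (derivative^[k] p).Splits ∧ ∀ z ∈ (derivative^[k] p).roots, z ∈ Set.Icc c d := by
  induction k with
  | zero => exact ⟨hp, h⟩
  | succ k ih =>
    rw [Function.iterate_succ_apply']
    exact ⟨ih.1.derivative_real, mem_Icc_of_mem_roots_derivative ih.1 ih.2⟩

theorem Monic.natDegree_iterate_derivative_real {p : ℝ[X]} (hp : p.Monic) {k : ℕ}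
    (hk : k ≤ p.natDegree) : (derivative^[k] p).natDegree = p.natDegree - k := by
  refine le_antisymm (natDegree_iterate_derivative p k) (le_natDegree_of_ne_zero ?_)
  rw [coeff_iterate_derivative, Nat.sub_add_cancel hk, hp.coeff_natDegree, nsmul_eq_mul, mul_one,
    Nat.cast_ne_zero]
  exact Nat.descFactorial_eq_zero_iff_lt.not.2 hk.not_gt

end Polynomial

end RootMeasure

/-- Let `(Q_n)` be monic real polynomials, all of whose roots are real and
lie in `[−C, 0]`, whose empirical root measures converge weakly to a finite measure `μ₀` on
`[−C,0]` of total mass `m > 0`.  Let `G₀(x) = ∫ dμ₀(u)/(x−u)` and, for `μ₀({0}) < y < m`,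
let `w₀(y) > 0` be the unique solution of `y = w₀(y)·G₀(w₀(y))`.  Then for every
`0 ≤ t < m`, the empirical root measures of the `⌊tn⌋`-th derivatives converge weakly to a
finite measure `μ_t` on `[−C,0]` of total mass `m − t` whose Cauchy–Stieltjes transform
`G_t` satisfies `y = w_t(y)·G_t(w_t(y))` for `max(μ₀({0})−t, 0) < y < m−t`, where
`w_t(y) = w₀(y+t)·y/(y+t)`. -/
theorem stmt_14 (C m : ℝ) (hC : 0 < C) (hm : 0 < m)
    (Q : ℕ → Polynomial ℝ)
    (hmonic : ∀ n, (Q n).Monic)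
    (hreal : ∀ n, ((Q n).roots.card = (Q n).natDegree))
    (hroots : ∀ n, ∀ z ∈ (Q n).roots, z ∈ Set.Icc (-C) 0)
    (μ₀ : Measure ℝ)
    (hμ₀supp : μ₀ (Set.Icc (-C) 0)ᶜ = 0)
    (hμ₀mass : μ₀ Set.univ = ENNReal.ofReal m)
    (hconv₀ : ∀ f : BoundedContinuousFunction ℝ ℝ,
      Tendsto (fun n => ∫ x, f x ∂(empRootMeasure n (Q n))) atTop (nhds (∫ x, f x ∂μ₀)))
    (w₀ : ℝ → ℝ)
    (hw₀ : ∀ y, (μ₀ {0}).toReal < y → y < m →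
      0 < w₀ y ∧ y = w₀ y * ∫ u, (w₀ y - u)⁻¹ ∂μ₀) :
    ∀ t, 0 ≤ t → t < m →
      ∃ μt : Measure ℝ,
        μt (Set.Icc (-C) 0)ᶜ = 0 ∧
        μt Set.univ = ENNReal.ofReal (m - t) ∧
        (∀ f : BoundedContinuousFunction ℝ ℝ,
          Tendsto
            (fun n => ∫ x, f x ∂(empRootMeasure n ((⇑derivative)^[⌊t * (n : ℝ)⌋₊] (Q n))))
            atTop (nhds (∫ x, f x ∂μt))) ∧
        (∀ y, max ((μ₀ {0}).toReal - t) 0 < y → y < m - t →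
          y = (w₀ (y + t) * y / (y + t)) *
              ∫ u, (w₀ (y + t) * y / (y + t) - u)⁻¹ ∂μt) := by
  intro t ht htm
  have hcd : -C ≤ 0 := neg_nonpos.2 hC.le
  have hmNN : IsFiniteMeasure μ₀ := ⟨by rw [hμ₀mass]; exact ENNReal.ofReal_lt_top⟩
  have hmreal : μ₀.real Set.univ = m := by
    rw [Measure.real, hμ₀mass, ENNReal.toReal_ofReal hm.le]
  have hsplits : ∀ n, (Q n).Splits := fun n => splits_iff_card_roots.2 (hreal n)
  have hQprod : ∀ n, Q n = ((Q n).roots.map fun z => X - Polynomial.C z).prod := fun n =>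
    (prod_multiset_X_sub_C_of_monic_of_roots_card_eq (hmonic n) (hreal n)).symm
  have hcoeff : ∀ n, (∀ j, 0 ≤ (Q n).coeff j) ∧ ∀ i j, i ≤ j →
      (Q n).coeff i * (Q n).coeff (j + 1) ≤ (Q n).coeff (i + 1) * (Q n).coeff j := fun n => by
    have h := coeff_prod_X_sub_C_nonneg_and_logConcave (Q n).roots fun z hz => (hroots n z hz).2
    rwa [← hQprod n] at h
  have hnn := fun n => (hcoeff n).1
  have hQs : ∀ n, empRootMeasure n (Q n) (Set.Icc (-C) 0)ᶜ = 0 := fun n =>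
    empRootMeasure_apply_eq_zero measurableSet_Icc.compl fun z hz => not_not.2 (hroots n z hz)
  set g : ℝ → ℝ := fun x => x * ∫ u, (x - u)⁻¹ ∂μ₀
  have hgm : MonotoneOn g (Set.Ioi 0) := monotoneOn_mul_integral_inv_sub hcd hμ₀supp
  have hgc : ContinuousOn g (Set.Ioi 0) := continuousOn_id.mul (continuousOn_integral_inv_sub hμ₀supp)
  have hL : ∀ x, 0 < x → Tendsto
      (fun n : ℕ => x * (derivative (Q n)).eval x / (n * (Q n).eval x)) atTop (nhds (g x)) := by
    intro x hx
    have h := (hconv₀ ((resolvent (ContinuousMap.coordIcc (-C) 0) x).extendIcc hcd)).const_mul x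
    simp only [integral_extendIcc_resolvent_coordIcc hcd hx (hQs _),
      integral_extendIcc_resolvent_coordIcc hcd hx hμ₀supp] at h
    refine h.congr fun n => mul_integral_inv_sub_empRootMeasure n (hsplits n) ?_
    exact (eval_pos_of_coeff_nonneg (hmonic n).ne_zero (hnn n) hx).ne'
  have hdegm : Tendsto (fun n : ℕ => ((Q n).natDegree : ℝ) / n) atTop (nhds m) := by
    have h := hconv₀ 1
    simp only [BoundedContinuousFunction.coe_one, Pi.one_apply] at h
    rw [integral_const, hmreal, smul_eq_mul, mul_one] at h
    refine h.congr fun n => ?_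
    rw [integral_empRootMeasure]
    simp [hreal n, div_eq_inv_mul]
  have hdeg : ∀ᶠ n : ℕ in atTop, ⌊t * n⌋₊ ≤ (Q n).natDegree := by
    filter_upwards [hdegm.eventually_const_lt htm, eventually_gt_atTop 0] with n hn hn0
    rw [lt_div_iff₀ (Nat.cast_pos.2 hn0)] at hn
    exact Nat.floor_le_of_le hn.le
  set D : ℕ → ℝ[X] := fun n => derivative^[⌊t * (n : ℝ)⌋₊] (Q n)
  have hDroots := fun n => splits_and_roots_iterate_derivative (hsplits n) (hroots n) ⌊t * (n : ℝ)⌋₊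
  have hDs : ∀ n, empRootMeasure n (D n) (Set.Icc (-C) 0)ᶜ = 0 := fun n =>
    empRootMeasure_apply_eq_zero measurableSet_Icc.compl fun z hz => not_not.2 ((hDroots n).2 z hz)
  have hDlim : ∀ v, 0 < v → t < g v → Tendsto (fun n => v * ((g v - t) / g v) *
      ∫ u, (v * ((g v - t) / g v) - u)⁻¹ ∂(empRootMeasure n (D n))) atTop (nhds (g v - t)) := by
    intro v hv htv
    refine (tendsto_logDeriv_iterate_derivative hmonic hnn (fun n => (hcoeff n).2) hgm hgc hL ht
      hdeg hv htv rfl).congr' ?_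
    filter_upwards [hdeg] with n hn
    rw [mul_integral_inv_sub_empRootMeasure n (hDroots n).1, Function.iterate_succ_apply']
    exact (eval_pos_of_coeff_nonneg (iterate_derivative_ne_zero (hmonic n) hn)
      (coeff_iterate_derivative_nonneg (hnn n) _)
      (mul_pos hv (div_pos (sub_pos.2 htv) (ht.trans_lt htv)))).ne'
  have hDmass : Tendsto (fun n => (empRootMeasure n (D n)).real Set.univ) atTop (nhds (m - t)) := by
    refine (hdegm.sub (tendsto_floor_mul_div ht)).congr' ?_
    filter_upwards [hdeg] with n hn
    rw [Measure.real, empRootMeasure_apply_univ, splits_iff_card_roots.1 (hDroots n).1,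
      (hmonic n).natDegree_iterate_derivative_real hn]
    rw [ENNReal.toReal_mul, ENNReal.toReal_inv, ENNReal.toReal_natCast, ENNReal.toReal_natCast,
      Nat.cast_sub hn]
    ring
  let ν : ℕ → FiniteMeasure ℝ := fun n =>
    ⟨empRootMeasure (n + 1) (D (n + 1)), isFiniteMeasure_empRootMeasure n.succ_ne_zero _⟩
  have hνmass : Tendsto (fun n => (ν n).mass) atTop (nhds (m - t).toNNReal) := by
    rw [← NNReal.tendsto_coe, Real.coe_toNNReal _ (sub_pos.2 htm).le]
    exact (tendsto_add_atTop_iff_nat 1).2 hDmass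
  obtain ⟨v₁, hv₁, htv₁⟩ : ∃ v, 0 < v ∧ t < g v := by
    have hmt := sub_pos.2 htm
    refine ⟨(t * C + 1) / (m - t), by positivity, lt_of_lt_of_le ?_
      (div_add_mul_le_mul_integral_inv_sub hC.le (by positivity) hμ₀supp)⟩
    rw [hmreal, div_mul_eq_mul_div, lt_div_iff₀ (by positivity)]
    field_simp
    nlinarith
  set h : ℝ → ℝ := fun v => v * ((g v - t) / g v) with hh
  have hgv : ∀ v ∈ Set.Icc v₁ (v₁ + 1), 0 < v ∧ t < g v := fun v hv => by
    have h0 := hv₁.trans_le hv.1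
    exact ⟨h0, htv₁.trans_le (hgm hv₁ h0 hv.1)⟩
  have hhc : ContinuousOn h (Set.Icc v₁ (v₁ + 1)) := by
    have hgc' : ContinuousOn g (Set.Icc v₁ (v₁ + 1)) := hgc.mono fun v hv => (hgv v hv).1
    exact continuousOn_id.mul ((hgc'.sub continuousOn_const).div hgc'
      fun v hv => (ht.trans_lt (hgv v hv).2).ne')
  have hh₁ : 0 < h v₁ := mul_pos hv₁ (div_pos (sub_pos.2 htv₁) (ht.trans_lt htv₁))
  have hhlt : h v₁ < h (v₁ + 1) := by
    have hg₁ : 0 < g v₁ := ht.trans_lt htv₁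
    have hle : g v₁ ≤ g (v₁ + 1) := hgm hv₁ (by simp only [Set.mem_Ioi]; linarith) (by linarith)
    have hfrac : (g v₁ - t) / g v₁ ≤ (g (v₁ + 1) - t) / g (v₁ + 1) := by
      rw [div_le_div_iff₀ hg₁ (hg₁.trans_le hle)]
      nlinarith
    have hpos : 0 < (g v₁ - t) / g v₁ := div_pos (sub_pos.2 htv₁) hg₁
    calc h v₁ < (v₁ + 1) * ((g v₁ - t) / g v₁) := by
          simp only [hh]; gcongr; linarith
      _ ≤ _ := by simp only [hh]; gcongr
  obtain ⟨μ, hμs, hμ⟩ := exists_tendsto_of_tendsto_cauchyTransform hcd hh₁.le hhlt ν hνmass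
    (fun n => hDs (n + 1)) (by
      intro x hx
      obtain ⟨v, hv, rfl⟩ := intermediate_value_Icc (by linarith) hhc (Set.Ioo_subset_Icc_self hx)
      obtain ⟨hv0, htv⟩ := hgv v hv
      have hne : h v ≠ 0 := (hh₁.trans hx.1).ne'
      refine ⟨(h v)⁻¹ * (g v - t), ?_⟩
      have hlim := ((tendsto_add_atTop_iff_nat 1).2 (hDlim v hv0 htv)).const_mul (h v)⁻¹
      refine hlim.congr fun n => ?_
      exact inv_mul_cancel_left₀ hne _)
  have hμint := FiniteMeasure.tendsto_iff_forall_integral_tendsto.1 hμ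
  refine ⟨μ, hμs, ?_, fun f => (tendsto_add_atTop_iff_nat 1).1 (hμint f), fun y hy hym => ?_⟩
  · have hmass := tendsto_nhds_unique ((FiniteMeasure.continuous_mass.tendsto μ).comp hμ) hνmass
    rw [← FiniteMeasure.ennreal_mass, hmass]
    rfl
  · obtain ⟨hy1, hy0⟩ := max_lt_iff.1 hy
    obtain ⟨hw, hyw⟩ := hw₀ (y + t) (by linarith) (by linarith)
    have hgw : g (w₀ (y + t)) = y + t := hyw.symm
    have hlim := hDlim _ hw (by linarith)
    rw [hgw, add_sub_cancel_right, ← mul_div_assoc] at hlim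
    have hx0 : 0 < w₀ (y + t) * y / (y + t) := by positivity
    have hlim' := (hμint ((resolvent (ContinuousMap.coordIcc (-C) 0)
      (w₀ (y + t) * y / (y + t))).extendIcc hcd)).const_mul (w₀ (y + t) * y / (y + t))
    rw [integral_extendIcc_resolvent_coordIcc hcd hx0 hμs] at hlim'
    refine tendsto_nhds_unique ((tendsto_add_atTop_iff_nat 1).2 hlim) (hlim'.congr fun n => ?_)
    exact congrArg _ (integral_extendIcc_resolvent_coordIcc hcd hx0 (hDs (n + 1)))
end
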